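/- For all r ∈ ℕ and k ≥ 3, there exists an integer n₀ = n₀(r,k) such that for every n ≥ n₀ and every r-edge-colouring of the complete k-uniform hypergraph K_n^(k), the vertex set of K_n^(k) can be partitioned into at most (2r)^(2^(k+4)) + 2^(k+8)·r·log(2r) vertex-disjoint monochromatic tight cycles. -/

import Mathlib

/-- A vertex set `C` forms a monochromatic tight cycle in the `χ`-edge-coloured complete
`k`-graph on `Fin n`: either `C` is degenerate (at most `k` vertices), or the vertices of `C`
can be cyclically ordered so that every `k` consecutive vertices form an edge, all of these
edges having the same colour. -/
def MonoTightCycle {n : ℕ} {α : Type*} (k : ℕ) (χ : Finset (Fin n) → α)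
    (C : Finset (Fin n)) : Prop :=
  C.card ≤ k ∨
  ∃ (g : ℕ → Fin n) (c : α),
    (∀ i, g (i + C.card) = g i) ∧
    Set.InjOn g (Set.Iio C.card) ∧
    (Finset.range C.card).image g = C ∧
    ∀ i, χ ((Finset.range k).image (fun j => g (i + j))) = c

open Finset Function

section Counting

open scoped Classical in
/-- The number of elements of a finite type satisfying `p`, as a real number. -/
noncomputable def cnt {α : Type*} [Fintype α] (p : α → Prop) : ℝ :=
  ((univ.filter p).card : ℝ)

variable {α β γ : Type*} [Fintype α] [Fintype β] [Fintype γ]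

lemma cnt_eq_sum (p : α → Prop) [DecidablePred p] :
    cnt p = ∑ a, if p a then (1 : ℝ) else 0 := by
  simp only [cnt, sum_boole]
  congr

lemma cnt_nonneg (p : α → Prop) : 0 ≤ cnt p := Nat.cast_nonneg _

lemma cnt_mono {p q : α → Prop} (h : ∀ a, p a → q a) : cnt p ≤ cnt q := by
  classical
  unfold cnt
  exact_mod_cast card_le_card (monotone_filter_right _ fun a _ => h a)

lemma cnt_congr {p q : α → Prop} (h : ∀ a, p a ↔ q a) : cnt p = cnt q :=
  le_antisymm (cnt_mono fun a => (h a).1) (cnt_mono fun a => (h a).2)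

lemma cnt_le_card (p : α → Prop) : cnt p ≤ Fintype.card α := by
  classical
  unfold cnt
  exact_mod_cast card_le_univ _

lemma cnt_or_le (p q : α → Prop) : cnt (fun a => p a ∨ q a) ≤ cnt p + cnt q := by
  classical
  simp only [cnt_eq_sum]
  rw [← sum_add_distrib]
  refine sum_le_sum fun a _ => ?_
  by_cases hp : p a <;> by_cases hq : q a <;> simp [hp, hq]

lemma exists_of_cnt_pos {p : α → Prop} (h : 0 < cnt p) : ∃ a, p a := by
  classical
  unfold cnt at h
  obtain ⟨a, ha⟩ := card_pos.1 (Nat.cast_pos.1 h)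
  exact ⟨a, (mem_filter.1 ha).2⟩

lemma exists_of_cnt_lt {p q : α → Prop} (h : cnt q < cnt p) : ∃ a, p a ∧ ¬ q a := by
  by_contra! hc
  exact absurd (cnt_mono hc) (not_le.2 h)

lemma cnt_mem_finset [DecidableEq α] (s : Finset α) : cnt (fun a => a ∈ s) = s.card := by
  classical
  unfold cnt
  congr 2
  ext; simp

lemma cnt_equiv (e : α ≃ β) (p : β → Prop) : cnt (fun a => p (e a)) = cnt p := by
  classical
  simp only [cnt_eq_sum]
  exact Fintype.sum_equiv e _ _ fun _ => rfl

lemma cnt_prod (p : α → β → Prop) :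
    cnt (fun x : α × β => p x.1 x.2) = ∑ a, cnt (p a) := by
  classical
  simp only [cnt_eq_sum, Fintype.sum_prod_type]

lemma cnt_prod_symm (p : α → β → Prop) :
    cnt (fun x : α × β => p x.1 x.2) = ∑ b, cnt (fun a => p a b) := by
  classical
  simp only [cnt_eq_sum, Fintype.sum_prod_type_right]

lemma cnt_and_prod (p : α → Prop) (q : β → Prop) :
    cnt (fun x : α × β => p x.1 ∧ q x.2) = cnt p * cnt q := by
  classical
  simp only [cnt_eq_sum, Fintype.sum_prod_type, Finset.sum_mul_sum]
  refine sum_congr rfl fun a _ => sum_congr rfl fun b _ => ?_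
  by_cases hp : p a <;> by_cases hq : q b <;> simp [hp, hq]

/-- Cauchy–Schwarz: duplicating the second coordinate costs at most a square in the density. -/
lemma cnt_clone (p : α → β → Prop) {e : ℝ} (he : 0 ≤ e)
    (h : e * (Fintype.card α * Fintype.card β) ≤ cnt (fun x : α × β => p x.1 x.2)) :
    e ^ 2 * (Fintype.card α * (Fintype.card β * Fintype.card β)) ≤
      cnt (fun x : α × β × β => p x.1 x.2.1 ∧ p x.1 x.2.2) := by
  rw [cnt_prod] at h
  rw [cnt_prod fun a (y : β × β) => p a y.1 ∧ p a y.2]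
  simp only [cnt_and_prod]
  rcases Nat.eq_zero_or_pos (Fintype.card α) with h0 | h0
  · simp only [h0, Nat.cast_zero, zero_mul, mul_zero]
    exact sum_nonneg fun a _ => mul_self_nonneg _
  have hpos : (0 : ℝ) < Fintype.card α := by exact_mod_cast h0
  have hcs := sq_sum_le_card_mul_sum_sq (s := (univ : Finset α)) (f := fun a => cnt (p a))
  have hsq : (e * (Fintype.card α * Fintype.card β)) ^ 2 ≤ (∑ a, cnt (p a)) ^ 2 :=
    pow_le_pow_left₀ (by positivity) h 2
  rw [card_univ] at hcs
  have := hsq.trans hcs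
  have h2 : (Fintype.card α : ℝ) * (e ^ 2 * (Fintype.card α * (Fintype.card β * Fintype.card β))) ≤
      Fintype.card α * ∑ a, cnt (p a) * cnt (p a) := by
    calc _ = (e * (Fintype.card α * Fintype.card β)) ^ 2 := by ring
      _ ≤ _ := this
      _ = _ := by simp only [sq]
  exact le_of_mul_le_mul_left h2 hpos

lemma cnt_popular (p : α → β → Prop) {e : ℝ} (he : 0 ≤ e)
    (h : 2 * e * (Fintype.card α * Fintype.card β) ≤ cnt (fun x : α × β => p x.1 x.2))
    (hβ : 0 < Fintype.card β) :
    e * Fintype.card α ≤ cnt (fun a => e * Fintype.card β ≤ cnt (p a)) := by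
  classical
  rw [cnt_prod] at h
  have hβ' : (0 : ℝ) < Fintype.card β := by exact_mod_cast hβ
  have h1 : ∀ a, cnt (p a) ≤ e * Fintype.card β +
      Fintype.card β * (if e * Fintype.card β ≤ cnt (p a) then (1 : ℝ) else 0) := by
    intro a
    split_ifs with ha
    · have := cnt_le_card (p a)
      have : 0 ≤ e * Fintype.card β := by positivity
      linarith [cnt_le_card (p a)]
    · push Not at ha
      linarith
  have h2 := h.trans (sum_le_sum fun a _ => h1 a)
  rw [sum_add_distrib, sum_const, card_univ, nsmul_eq_mul, ← mul_sum] at h2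
  rw [cnt_eq_sum (fun a => e * (Fintype.card β : ℝ) ≤ cnt (p a))]
  have h3 : Fintype.card β * (e * Fintype.card α) ≤
      Fintype.card β * ∑ a, (if e * (Fintype.card β : ℝ) ≤ cnt (p a) then (1 : ℝ) else 0) := by
    linarith
  exact le_of_mul_le_mul_left h3 hβ'

/-- A family of dense sets with pairwise sparse intersections is small. -/
lemma card_le_of_sparse_inter {ι : Type*} (S : Finset ι) (p : ι → α → Prop) {δ : ℝ}
    (h0 : 0 < δ) (h1 : δ ≤ 1) (hd : ∀ i ∈ S, δ * Fintype.card α ≤ cnt (p i))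
    (hi : ∀ i ∈ S, ∀ j ∈ S, i ≠ j →
      cnt (fun a => p i a ∧ p j a) < δ ^ 2 / 2 * Fintype.card α) :
    (S.card : ℝ) ≤ 2 / δ := by
  classical
  by_contra! hc
  rw [div_lt_iff₀ h0] at hc
  have hα : (0 : ℝ) < Fintype.card α := by
    rcases Nat.eq_zero_or_pos (Fintype.card α) with h | h
    · have h2 : 1 < S.card := by
        by_contra! h3
        have : (S.card : ℝ) ≤ 1 := by exact_mod_cast h3
        nlinarith
      obtain ⟨i, hi1, j, hj1, hij⟩ := one_lt_card.1 h2
      have := hi i hi1 j hj1 hij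
      rw [h] at this
      have h4 := cnt_nonneg (fun a => p i a ∧ p j a)
      simp at this
      linarith
    · exact_mod_cast h
  set N : ℝ := (Fintype.card α : ℝ) with hN
  set A : ℝ := ∑ i ∈ S, cnt (p i) with hA
  have hAge : S.card * δ * N ≤ A := by
    have := card_nsmul_le_sum S (fun i => cnt (p i)) (δ * N) hd
    rw [nsmul_eq_mul] at this
    linarith
  have hcs := sq_sum_le_card_mul_sum_sq (s := (univ : Finset α))
    (f := fun a => ∑ i ∈ S, if p i a then (1 : ℝ) else 0)
  have e1 : ∑ a : α, ∑ i ∈ S, (if p i a then (1 : ℝ) else 0) = A := by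
    rw [sum_comm]
    exact sum_congr rfl fun i _ => (cnt_eq_sum _).symm
  have e2 : ∑ a : α, (∑ i ∈ S, if p i a then (1 : ℝ) else 0) ^ 2 =
      ∑ i ∈ S, ∑ j ∈ S, cnt (fun a => p i a ∧ p j a) := by
    simp only [sq, sum_mul_sum, cnt_eq_sum]
    rw [sum_comm]
    refine sum_congr rfl fun i _ => ?_
    rw [sum_comm]
    refine sum_congr rfl fun j _ => sum_congr rfl fun a _ => ?_
    by_cases h : p i a <;> by_cases h' : p j a <;> simp [h, h']
  rw [e1, e2, card_univ] at hcs
  have e3 : ∑ i ∈ S, ∑ j ∈ S, cnt (fun a => p i a ∧ p j a) ≤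
      A + S.card * S.card * (δ ^ 2 / 2 * N) := by
    have : ∀ i ∈ S, ∑ j ∈ S, cnt (fun a => p i a ∧ p j a) ≤
        cnt (p i) + S.card * (δ ^ 2 / 2 * N) := by
      intro i hiS
      have hle : ∀ j ∈ S, cnt (fun a => p i a ∧ p j a) ≤
          (if i = j then cnt (p i) else 0) + δ ^ 2 / 2 * N := by
        intro j hj
        split_ifs with hij
        · have := cnt_mono (p := fun a => p i a ∧ p j a) (q := p i) fun a h => h.1
          have : 0 ≤ δ ^ 2 / 2 * N := by positivity
          linarith
        · linarith [hi i hiS j hj hij]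
      refine (sum_le_sum hle).trans ?_
      rw [sum_add_distrib, sum_ite_eq, if_pos hiS, sum_const, nsmul_eq_mul]
    refine (sum_le_sum this).trans ?_
    rw [sum_add_distrib, sum_const, nsmul_eq_mul]
    linarith
  have hu : 0 ≤ S.card * δ := by positivity
  have hAN : 2 * N < A := by nlinarith
  have h5 : A ^ 2 ≤ N * A + (S.card * δ * N) ^ 2 / 2 := by nlinarith
  have h6 : (S.card * δ * N) ^ 2 ≤ A ^ 2 := pow_le_pow_left₀ (by positivity) hAge 2
  nlinarith

end Counting

section Boxes

lemma cnt_le_of_injective {α β : Type*} [Fintype α] [Fintype β] {p : α → Prop} {q : β → Prop}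
    (g : α → β) (hg : Injective g) (h : ∀ a, p a → q (g a)) : cnt p ≤ cnt q := by
  classical
  unfold cnt
  exact_mod_cast card_le_card_of_injOn g (fun a ha => by
    simpa using h a (by simpa using ha)) hg.injOn

lemma cnt_exists_le {α ι : Type*} [Fintype α] [Fintype ι] (p : ι → α → Prop) :
    cnt (fun a => ∃ i, p i a) ≤ ∑ i, cnt (p i) := by
  classical
  simp only [cnt_eq_sum]
  rw [sum_comm]
  refine sum_le_sum fun a _ => ?_
  split_ifs with h
  · obtain ⟨i, hi⟩ := h
    have := single_le_sum (f := fun i => if p i a then (1 : ℝ) else 0)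
      (fun i _ => by split_ifs <;> norm_num) (mem_univ i)
    simpa [hi] using this
  · exact sum_nonneg fun i _ => by split_ifs <;> norm_num

/-- `f` holds at all vertices of the combinatorial box spanned by `x` and `y`. -/
def Box {m : ℕ} {W : Type*} (f : (Fin m → W) → Prop) (x y : Fin m → W) : Prop :=
  ∀ s : Fin m → Bool, f (fun i => bif s i then y i else x i)

lemma Box.symm {m : ℕ} {W : Type*} {f : (Fin m → W) → Prop} {x y : Fin m → W}
    (h : Box f x y) : Box f y x := by
  intro s
  have := h fun i => !s i
  have e : (fun i => bif !s i then y i else x i) = fun i => bif s i then x i else y i := by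
    funext i
    cases s i <;> rfl
  rwa [e] at this

lemma Box.cons {m : ℕ} {W : Type*} {f : (Fin (m + 1) → W) → Prop} {x y : Fin m → W} {w w' : W}
    (h : Box (fun t => f (Fin.cons w t)) x y) (h' : Box (fun t => f (Fin.cons w' t)) x y) :
    Box f (Fin.cons w x) (Fin.cons w' y) := by
  intro s
  have e : (fun i => bif s i then (Fin.cons w' y : Fin (m + 1) → W) i
      else (Fin.cons w x : Fin (m + 1) → W) i) =
      Fin.cons (bif s 0 then w' else w) fun i => bif s i.succ then y i else x i := by
    funext i
    refine Fin.cases ?_ (fun i => ?_) i <;> simp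
  rw [e]
  cases s 0
  · exact h fun i => s i.succ
  · exact h' fun i => s i.succ

/-- A dense set of `m`-tuples spans a positive proportion of all boxes. -/
lemma box_count {W : Type} [Fintype W] : ∀ (m : ℕ) {A : Type} [Fintype A]
    (f : A → (Fin m → W) → Prop) {d : ℝ}, 0 ≤ d →
    d * (Fintype.card A * Fintype.card (Fin m → W)) ≤
      cnt (fun x : A × (Fin m → W) => f x.1 x.2) →
    d ^ 2 ^ m * (Fintype.card A * (Fintype.card (Fin m → W) * Fintype.card (Fin m → W))) ≤
      cnt (fun x : A × (Fin m → W) × (Fin m → W) => Box (f x.1) x.2.1 x.2.2)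
  | 0, A, _, f, d, _, h => by
    refine le_trans ?_ (h.trans (cnt_le_of_injective (fun x => (x.1, x.2, x.2)) ?_ ?_))
    · simp
    · intro x y hxy
      simp only [Prod.mk.injEq] at hxy
      exact Prod.ext hxy.1 hxy.2.1
    · intro a ha s
      exact (congrArg (f a.1) (Subsingleton.elim _ _)).mp ha
  | m + 1, A, _, f, d, hd, h => by
    have e1 : (Fintype.card (Fin (m + 1) → W) : ℝ) =
        Fintype.card W * Fintype.card (Fin m → W) := by
      simp [pow_succ, mul_comm]
    have h1 := box_count (W := W) m (A := A × W) (fun a t => f a.1 (Fin.cons a.2 t)) hd (by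
      refine le_trans (le_of_eq ?_) (h.trans (le_of_eq ?_))
      · rw [e1, Fintype.card_prod]; push_cast; ring
      · rw [← cnt_equiv ((Equiv.prodAssoc A W (Fin m → W)).trans
          (Equiv.prodCongr (Equiv.refl A) (Fin.consEquiv fun _ => W)))]
        rfl)
    have h2 := cnt_clone (α := A × (Fin m → W) × (Fin m → W)) (β := W)
      (fun a w => Box (fun t => f a.1 (Fin.cons w t)) a.2.1 a.2.2)
      (e := d ^ 2 ^ m) (by positivity) (by
        refine le_trans (le_of_eq ?_) (h1.trans (cnt_le_of_injective
          (fun x => ((x.1.1, x.2), x.1.2)) ?_ ?_))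
        · simp only [Fintype.card_prod]; push_cast; ring
        · rintro ⟨⟨a, w⟩, x⟩ ⟨⟨a', w'⟩, x'⟩ hx
          simp only [Prod.mk.injEq] at hx ⊢
          tauto
        · exact fun a ha => ha)
    refine le_trans (le_of_eq ?_) (h2.trans (cnt_le_of_injective
      (fun x => (x.1.1, Fin.cons x.2.1 x.1.2.1, Fin.cons x.2.2 x.1.2.2)) ?_ ?_))
    · rw [e1]; simp only [Fintype.card_prod]; push_cast; ring
    · rintro ⟨⟨a, x, y⟩, w, w'⟩ ⟨⟨b, x', y'⟩, v, v'⟩ hx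
      simp only [Prod.mk.injEq, Fin.cons_inj] at hx ⊢
      tauto
    · exact fun a ha => Box.cons ha.1 ha.2

/-- Few maps `ι → W` are non-injective or hit a small set `U`. -/
lemma cnt_bad_le {ι W : Type*} [Fintype ι] [DecidableEq ι] [Fintype W] [DecidableEq W]
    (U : Finset W) :
    cnt (fun t : ι → W => ¬ Injective t ∨ ∃ i, t i ∈ U) * Fintype.card W ≤
      Fintype.card ι * (Fintype.card ι + U.card) * Fintype.card (ι → W) := by
  have h1 : cnt (fun t : ι → W => ¬ Injective t ∨ ∃ i, t i ∈ U) ≤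
      ∑ i, cnt (fun t : ι → W => t i ∈ U ∪ univ.image fun j : {j // j ≠ i} => t j) := by
    refine le_trans (cnt_mono ?_) (cnt_exists_le _)
    rintro t (h | ⟨i, hi⟩)
    · simp only [Injective, not_forall] at h
      obtain ⟨i, j, hij, hne⟩ := h
      exact ⟨i, mem_union_right _ (mem_image.2 ⟨⟨j, Ne.symm hne⟩, mem_univ _, hij.symm⟩)⟩
    · exact ⟨i, mem_union_left _ hi⟩
  have h2 : ∀ i, cnt (fun t : ι → W => t i ∈ U ∪ univ.image fun j : {j // j ≠ i} => t j) *
      Fintype.card W ≤ (Fintype.card ι + U.card) * Fintype.card (ι → W) := by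
    intro i
    have e := cnt_equiv (Equiv.funSplitAt i W)
      fun x : W × ({j // j ≠ i} → W) => x.1 ∈ U ∪ univ.image x.2
    have e' : cnt (fun t : ι → W => t i ∈ U ∪ univ.image fun j : {j // j ≠ i} => t j) =
        ∑ u : {j // j ≠ i} → W, cnt (fun w => w ∈ U ∪ univ.image u) := by
      rw [← cnt_prod_symm fun w (u : {j // j ≠ i} → W) => w ∈ U ∪ univ.image u, ← e]
      rfl
    have hc : (Fintype.card (ι → W) : ℝ) =
        Fintype.card W * Fintype.card ({j // j ≠ i} → W) := by
      rw [Fintype.card_congr (Equiv.funSplitAt i W), Fintype.card_prod]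
      push_cast; rfl
    have h3 : ∑ u : {j // j ≠ i} → W, cnt (fun w => w ∈ U ∪ univ.image u) ≤
        Fintype.card ({j // j ≠ i} → W) * (Fintype.card ι + U.card) := by
      rw [← nsmul_eq_mul, ← card_univ]
      refine sum_le_card_nsmul _ _ _ fun u _ => ?_
      rw [cnt_mem_finset]
      have a1 := card_union_le U (univ.image u)
      have a2 : (univ.image u).card ≤ Fintype.card ι :=
        card_image_le.trans (by rw [card_univ]; exact Fintype.card_subtype_le _)
      have a3 : (U ∪ univ.image u).card ≤ Fintype.card ι + U.card := by omega
      exact_mod_cast a3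
    rw [e', hc]
    have : (0 : ℝ) ≤ Fintype.card W := Nat.cast_nonneg _
    nlinarith
  refine (mul_le_mul_of_nonneg_right h1 (Nat.cast_nonneg _)).trans ?_
  rw [sum_mul]
  refine (sum_le_sum fun i _ => h2 i).trans ?_
  rw [sum_const, card_univ, nsmul_eq_mul]
  linarith

end Boxes

section CycleCover

variable {P : Type*} [DecidableEq P]

/-- In a finite reflexive graph, some cycle contains a vertex together with all of its
neighbours. -/
lemma exists_cycle_closed_vertex (rel : P → P → Prop) (hr : ∀ p, rel p p)
    (hs : ∀ p q, rel p q → rel q p) (S : Finset P) (hS : S.Nonempty) :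
    ∃ l : List P, l ≠ [] ∧ l.Nodup ∧ (∀ p ∈ l, p ∈ S) ∧ (∀ p ∈ l, rel p (l.formPerm p)) ∧
      ∃ u ∈ l, ∀ q ∈ S, rel u q → q ∈ l := by
  classical
  let good : List P → Prop := fun l => l ≠ [] ∧ l.Nodup ∧ (∀ p ∈ l, p ∈ S) ∧ l.IsChain rel
  have hlen : ∀ l, good l → l.length ≤ S.card := fun l hl => by
    rw [← List.toFinset_card_of_nodup hl.2.1]
    exact card_le_card fun p hp => hl.2.2.1 p (List.mem_toFinset.1 hp)
  obtain ⟨p, hp⟩ := hS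
  have hex : ∃ m, ∃ l, good l ∧ l.length = m := ⟨1, [p], by simp [good, hp], rfl⟩
  have hbd : ∀ m, (∃ l, good l ∧ l.length = m) → m ≤ S.card := by
    rintro m ⟨l, hl, rfl⟩
    exact hlen l hl
  obtain ⟨l, hl, hm⟩ := Nat.findGreatest_spec (P := fun m => ∃ l, good l ∧ l.length = m)
    (hbd _ hex.choose_spec) hex.choose_spec
  have hmax : ∀ l', good l' → l'.length ≤ l.length := fun l' hl' => by
    rw [hm]
    exact Nat.le_findGreatest (hlen l' hl') ⟨l', hl', rfl⟩
  obtain ⟨hne, hnd, hlS, hch⟩ := hl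
  have h0 : 0 < l.length := List.length_pos_iff.2 hne
  have hnb : ∀ q ∈ S, rel l[0] q → q ∈ l := by
    intro q hq hrel
    by_contra hql
    have : good (q :: l) := by
      refine ⟨by simp, List.nodup_cons.2 ⟨hql, hnd⟩, ?_, ?_⟩
      · intro p hp
        rcases List.mem_cons.1 hp with rfl | hp
        · exact hq
        · exact hlS p hp
      · obtain ⟨x, t, rfl⟩ := List.exists_cons_of_ne_nil hne
        exact List.isChain_cons_cons.2 ⟨hs _ _ hrel, hch⟩
    have := hmax _ this
    simp at this
  let near : ℕ → Prop := fun i => ∃ h : i < l.length, rel l[0] l[i]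
  have hn0 : near 0 := ⟨h0, hr _⟩
  set i := Nat.findGreatest near l.length with hi
  obtain ⟨hil, hirel⟩ : near i := Nat.findGreatest_spec (Nat.zero_le _) hn0
  have himax : ∀ j, near j → j ≤ i := fun j hj => Nat.le_findGreatest hj.1.le hj
  have hlen' : (l.take (i + 1)).length = i + 1 := by simp; omega
  have hnd' : (l.take (i + 1)).Nodup := hnd.sublist (List.take_sublist _ _)
  refine ⟨l.take (i + 1), by simpa using hne, hnd',
    fun p hp => hlS p (List.mem_of_mem_take hp), ?_, l[0], ?_, ?_⟩
  · intro p hp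
    obtain ⟨j, hj, rfl⟩ := List.getElem_of_mem hp
    rw [List.formPerm_apply_getElem _ hnd' j hj]
    simp only [hlen', List.getElem_take]
    rw [hlen'] at hj
    rcases Nat.lt_or_ge (j + 1) (i + 1) with h | h
    · simp only [Nat.mod_eq_of_lt h]
      exact List.isChain_iff_getElem.1 hch j (by omega)
    · obtain rfl : j = i := by omega
      simp only [Nat.mod_self]
      exact hs _ _ hirel
  · exact List.mem_take_iff_getElem.2 ⟨0, by omega, rfl⟩
  · intro q hq hrel
    obtain ⟨j, hj, rfl⟩ := List.getElem_of_mem (hnb q hq hrel)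
    have := himax j ⟨hj, hrel⟩
    exact List.mem_take_iff_getElem.2 ⟨j, by omega, rfl⟩

/-- A finite reflexive graph without independent sets of more than `a` vertices can be
partitioned into at most `a` cycles. -/
lemma exists_cycle_cover (rel : P → P → Prop) (hr : ∀ p, rel p p)
    (hs : ∀ p q, rel p q → rel q p) (a : ℕ) (S : Finset P)
    (hI : ∀ I ⊆ S, (∀ p ∈ I, ∀ q ∈ I, p ≠ q → ¬ rel p q) → I.card ≤ a) :
    ∃ (nx : P → P) (𝒪 : Finset (Finset P)), (𝒪 : Set (Finset P)).PairwiseDisjoint id ∧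
      𝒪.biUnion id = S ∧ 𝒪.card ≤ a ∧
      (∀ O ∈ 𝒪, ∃ p, 0 < O.card ∧ O = (range O.card).image (fun i => nx^[i] p) ∧
        nx^[O.card] p = p) ∧
      ∀ p ∈ S, rel p (nx p) ∧ nx p ∈ S := by
  induction a generalizing S with
  | zero =>
    have : S = ∅ := by
      by_contra h
      obtain ⟨p, hp⟩ := nonempty_iff_ne_empty.2 h
      have := hI {p} (by simpa using hp) (by simp)
      simp at this
    subst this
    exact ⟨id, ∅, by simp⟩
  | succ a ih =>
    rcases S.eq_empty_or_nonempty with rfl | hne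
    · exact ⟨id, ∅, by simp⟩
    obtain ⟨l, hl, hnd, hlS, hrel, u, hul, hu⟩ := exists_cycle_closed_vertex rel hr hs S hne
    have hlsub : l.toFinset ⊆ S := fun p hp => hlS p (List.mem_toFinset.1 hp)
    obtain ⟨nx, 𝒪, hdisj, hunion, hcard, horb, hnx⟩ := ih (S \ l.toFinset) (by
      intro I hIS hind
      have hsub : ∀ p ∈ I, p ∈ S ∧ p ∉ l := fun p hp => by simpa using hIS hp
      have huI : u ∉ I := fun h => (hsub u h).2 hul
      have hbig := hI (insert u I) (by
          intro p hp
          rcases mem_insert.1 hp with rfl | hp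
          · exact hlS _ hul
          · exact (hsub p hp).1) (by
          intro p hp q hq hpq
          rcases mem_insert.1 hp with h1 | h1 <;> rcases mem_insert.1 hq with h2 | h2
          · exact absurd (h1.trans h2.symm) hpq
          · subst h1
            exact fun h => (hsub q h2).2 (hu q (hsub q h2).1 h)
          · subst h2
            exact fun h => (hsub p h1).2 (hu p (hsub p h1).1 (hs _ _ h))
          · exact hind p h1 q h2 hpq)
      rw [card_insert_of_notMem huI] at hbig
      omega)
    have hOl : ∀ O ∈ 𝒪, ∀ p ∈ O, p ∉ l := fun O hO p hp => by
      have : p ∈ S \ l.toFinset := hunion ▸ mem_biUnion.2 ⟨O, hO, hp⟩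
      simpa using (mem_sdiff.1 this).2
    let nx' : P → P := fun p => if p ∈ l then l.formPerm p else nx p
    have hitl : ∀ (i : ℕ), ∀ p ∈ l, nx'^[i] p = (l.formPerm ^ i) p ∧ nx'^[i] p ∈ l := by
      intro i p hp
      induction i with
      | zero => simpa using hp
      | succ i ihi =>
        have e : nx'^[i + 1] p = l.formPerm (nx'^[i] p) := by
          rw [iterate_succ_apply']; simp only [nx', if_pos ihi.2]
        rw [e]
        refine ⟨by rw [ihi.1, pow_succ', Equiv.Perm.mul_apply], ?_⟩
        exact List.formPerm_apply_mem_of_mem ihi.2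
    have hlpos : 0 < l.length := List.length_pos_iff.2 hl
    refine ⟨nx', insert l.toFinset 𝒪, ?_, ?_, ?_, ?_, ?_⟩
    · rw [coe_insert, Set.pairwiseDisjoint_insert]
      refine ⟨hdisj, fun O hO _ => ?_⟩
      exact disjoint_left.2 fun p hp hpO => hOl O hO p hpO (List.mem_toFinset.1 hp)
    · rw [biUnion_insert, hunion]
      exact union_sdiff_of_subset hlsub
    · exact (card_insert_le _ _).trans (by omega)
    · intro O hO
      rcases mem_insert.1 hO with rfl | hO
      · have hc : l.toFinset.card = l.length := List.toFinset_card_of_nodup hnd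
        have hget : ∀ i, nx'^[i] l[0] = l[i % l.length]'(Nat.mod_lt _ hlpos) := by
          intro i
          rw [(hitl i _ (List.getElem_mem hlpos)).1, List.formPerm_pow_apply_getElem _ hnd]
          simp
        refine ⟨l[0], by omega, ?_, ?_⟩
        · ext p
          simp only [List.mem_toFinset, mem_image, mem_range, hc, hget]
          constructor
          · intro hp
            obtain ⟨j, hj, rfl⟩ := List.getElem_of_mem hp
            exact ⟨j, hj, by simp only [Nat.mod_eq_of_lt hj]⟩
          · rintro ⟨j, _, rfl⟩
            exact List.getElem_mem _
        · rw [hc, hget]; simp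
      · obtain ⟨p, hpos, himg, hper⟩ := horb O hO
        have hit : ∀ i ≤ O.card, nx'^[i] p = nx^[i] p := by
          intro i hi
          induction i with
          | zero => rfl
          | succ i ihi =>
            rw [iterate_succ_apply', iterate_succ_apply', ihi (by omega)]
            have : nx^[i] p ∈ O := by
              rw [himg]
              exact mem_image_of_mem _ (mem_range.2 (by omega))
            simp only [nx', if_neg (hOl O hO _ this)]
        refine ⟨p, hpos, ?_, by rw [hit _ le_rfl, hper]⟩
        rw [himg]
        have : ((range O.card).image fun i => nx^[i] p).card = O.card := by rw [← himg]
        rw [this]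
        exact image_congr fun i hi => (hit i (by simpa using (mem_range.1 hi).le)).symm
    · intro p hp
      by_cases hpl : p ∈ l
      · simp only [nx', if_pos hpl]
        exact ⟨hrel p hpl, hlS _ (List.formPerm_apply_mem_of_mem hpl)⟩
      · simp only [nx', if_neg hpl]
        have := hnx p (by simp [hp, hpl])
        exact ⟨this.1, (mem_sdiff.1 this.2).1⟩

end CycleCover

section PathCount

lemma mul_cnt_le_sum {α : Type*} [Fintype α] (p : α → Prop) (f : α → ℝ) {c : ℝ}
    (h0 : ∀ a, 0 ≤ f a) (h : ∀ a, p a → c ≤ f a) : c * cnt p ≤ ∑ a, f a := by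
  classical
  rw [cnt_eq_sum, mul_sum]
  refine sum_le_sum fun a _ => ?_
  split_ifs with ha
  · simpa using h a ha
  · simpa using h0 a

/-- Dependent random choice: a dense bipartite graph contains large sets `R` and `Y` such that
any vertex of `R` and any vertex of `Y` are joined by many paths of length three. -/
lemma exists_dense_path_sets {V X : Type*} [Fintype V] [Fintype X]
    (B : V → X → Prop) {β : ℝ} (hβ : 0 < β) (hV : 0 < Fintype.card V) (hX : 0 < Fintype.card X)
    (h : β * (Fintype.card V * Fintype.card X) ≤ cnt (fun p : V × X => B p.1 p.2)) :
    ∃ (R : Finset V) (Y : Finset X), β / 8 * Fintype.card V ≤ R.card ∧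
      β / 4 * Fintype.card X ≤ Y.card ∧ ∀ v ∈ R, ∀ i ∈ Y,
        β ^ 5 / 4096 * (Fintype.card V * Fintype.card X) ≤
          cnt (fun p : V × X => B p.1 i ∧ B p.1 p.2 ∧ B v p.2) := by
  classical
  have hN : (0 : ℝ) < Fintype.card V := by exact_mod_cast hV
  have hx : (0 : ℝ) < Fintype.card X := by exact_mod_cast hX
  set N : ℝ := (Fintype.card V : ℝ)
  set x : ℝ := (Fintype.card X : ℝ)
  set η : ℝ := β ^ 3 / 128 with hη
  have hη0 : 0 < η := by positivity
  let big : V → Prop := fun v => β / 2 * x ≤ cnt (B v)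
  let few : V → V → Prop := fun v w => cnt (fun ξ => B v ξ ∧ B w ξ) < η * x
  let z : X → ℝ := fun ξ => cnt fun v => big v ∧ B v ξ
  let b : X → ℝ := fun ξ => cnt fun p : V × V =>
    (big p.1 ∧ B p.1 ξ) ∧ (big p.2 ∧ B p.2 ξ) ∧ few p.1 p.2
  have hz : β / 2 * (N * x) ≤ ∑ ξ, z ξ := by
    have e : ∑ ξ, z ξ = ∑ v, cnt fun ξ => big v ∧ B v ξ := by
      rw [← cnt_prod_symm fun v ξ => big v ∧ B v ξ, cnt_prod fun v ξ => big v ∧ B v ξ]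
    rw [e]
    have h1 : ∀ v, cnt (B v) ≤ cnt (fun ξ => big v ∧ B v ξ) + β / 2 * x := by
      intro v
      by_cases hv : big v
      · have : cnt (B v) ≤ cnt (fun ξ => big v ∧ B v ξ) := cnt_mono fun ξ hξ => ⟨hv, hξ⟩
        have : 0 ≤ β / 2 * x := by positivity
        linarith
      · have : cnt (B v) < β / 2 * x := not_le.1 hv
        linarith [cnt_nonneg fun ξ => big v ∧ B v ξ]
    have h2 := sum_le_sum (s := univ) fun v _ => h1 v
    rw [sum_add_distrib, sum_const, card_univ, nsmul_eq_mul, ← cnt_prod] at h2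
    have h3 : (Fintype.card V : ℝ) = N := rfl
    rw [h3] at h2
    linarith
  have hz2 : β ^ 2 / 4 * N ^ 2 * x ≤ ∑ ξ, z ξ ^ 2 := by
    have hcs := sq_sum_le_card_mul_sum_sq (s := (univ : Finset X)) (f := z)
    rw [card_univ] at hcs
    have h1 : (β / 2 * (N * x)) ^ 2 ≤ (∑ ξ, z ξ) ^ 2 := pow_le_pow_left₀ (by positivity) hz 2
    refine le_of_mul_le_mul_left (a := x) ?_ hx
    calc x * (β ^ 2 / 4 * N ^ 2 * x) = (β / 2 * (N * x)) ^ 2 := by ring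
      _ ≤ _ := h1.trans hcs
  have hb : ∑ ξ, b ξ ≤ η * x * N ^ 2 := by
    have e : ∑ ξ, b ξ = ∑ p : V × V, cnt fun ξ =>
        (big p.1 ∧ B p.1 ξ) ∧ (big p.2 ∧ B p.2 ξ) ∧ few p.1 p.2 := by
      rw [← cnt_prod_symm fun (p : V × V) ξ =>
        (big p.1 ∧ B p.1 ξ) ∧ (big p.2 ∧ B p.2 ξ) ∧ few p.1 p.2, cnt_prod fun (p : V × V) ξ =>
        (big p.1 ∧ B p.1 ξ) ∧ (big p.2 ∧ B p.2 ξ) ∧ few p.1 p.2]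
    rw [e]
    refine (sum_le_card_nsmul univ _ (η * x) fun p _ => ?_).trans (le_of_eq ?_)
    · by_cases hp : few p.1 p.2
      · exact (cnt_mono fun ξ hξ => ⟨hξ.1.2, hξ.2.1.2⟩).trans (le_of_lt hp)
      · refine (cnt_mono (q := fun _ => False) fun ξ hξ => hp hξ.2.2).trans ?_
        simp only [cnt_eq_sum, if_false, sum_const_zero]
        positivity
    · rw [card_univ, Fintype.card_prod, nsmul_eq_mul]
      push_cast
      ring
  obtain ⟨ξ, -, hξ⟩ : ∃ ξ ∈ (univ : Finset X),
      β ^ 2 / 8 * N ^ 2 ≤ z ξ ^ 2 - 16 / β * b ξ := by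
    refine exists_le_of_sum_le ⟨(Fintype.card_pos_iff.1 hX).some, mem_univ _⟩ ?_
    rw [sum_const, card_univ, nsmul_eq_mul, sum_sub_distrib, ← mul_sum]
    have h1 : 16 / β * ∑ ξ, b ξ ≤ 16 / β * (η * x * N ^ 2) :=
      mul_le_mul_of_nonneg_left hb (by positivity)
    have h2 : 16 / β * (η * x * N ^ 2) = β ^ 2 / 8 * N ^ 2 * x := by
      rw [hη]; field_simp; norm_num
    have h3 : (Fintype.card X : ℝ) = x := rfl
    rw [h3]
    nlinarith
  set V₀ : Finset V := univ.filter fun v => big v ∧ B v ξ with hV₀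
  have hzc : z ξ = V₀.card := by
    rw [← cnt_mem_finset]
    exact cnt_congr fun v => by simp [hV₀]
  have hb0 : 0 ≤ b ξ := cnt_nonneg _
  have hz0 : β / 4 * N ≤ z ξ := by
    have h1 : 0 ≤ 16 / β * b ξ := by positivity
    refine le_of_sq_le_sq ?_ (cnt_nonneg _)
    nlinarith [sq_nonneg (β * N)]
  have hzpos : 0 < z ξ := lt_of_lt_of_le (by positivity) hz0
  have hbz : b ξ ≤ β / 16 * z ξ ^ 2 := by
    have h1 : 16 / β * b ξ ≤ z ξ ^ 2 := by
      have : 0 ≤ β ^ 2 / 8 * N ^ 2 := by positivity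
      linarith
    rw [div_mul_eq_mul_div, div_le_iff₀ hβ] at h1
    linarith
  let nb : V → ℝ := fun v => cnt fun d => d ∈ V₀ ∧ few v d
  have hnb : ∑ v ∈ V₀, nb v ≤ b ξ := by
    have e : b ξ = ∑ v, cnt fun d => (big v ∧ B v ξ) ∧ (big d ∧ B d ξ) ∧ few v d :=
      cnt_prod fun v d => (big v ∧ B v ξ) ∧ (big d ∧ B d ξ) ∧ few v d
    rw [e]
    refine (sum_le_sum fun v hv => cnt_mono fun d hd => ?_).trans
      (sum_le_univ_sum_of_nonneg fun v => cnt_nonneg _)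
    exact ⟨(mem_filter.1 hv).2, (mem_filter.1 hd.1).2, hd.2⟩
  refine ⟨V₀.filter fun v => nb v ≤ β / 8 * z ξ,
    univ.filter fun i => β / 4 * V₀.card ≤ cnt fun d : V₀ => B d i, ?_, ?_, ?_⟩
  · have h1 : ((V₀.filter fun v => ¬ nb v ≤ β / 8 * z ξ).card : ℝ) * (β / 8 * z ξ) ≤ b ξ := by
      refine le_trans ?_ ((sum_le_sum_of_subset_of_nonneg (filter_subset
        (fun v => ¬ nb v ≤ β / 8 * z ξ) V₀) fun v _ _ => cnt_nonneg _).trans hnb)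
      rw [← nsmul_eq_mul]
      exact card_nsmul_le_sum _ _ _ fun v hv => (not_le.1 (mem_filter.1 hv).2).le
    have h2 : ((V₀.filter fun v => nb v ≤ β / 8 * z ξ).card : ℝ) +
        (V₀.filter fun v => ¬ nb v ≤ β / 8 * z ξ).card = z ξ := by
      rw [hzc]
      exact_mod_cast card_filter_add_card_filter_not _
    have h3 : ((V₀.filter fun v => ¬ nb v ≤ β / 8 * z ξ).card : ℝ) ≤ z ξ / 2 := by
      refine le_of_mul_le_mul_right (a := β / 8 * z ξ) ?_ (by positivity)
      nlinarith
    linarith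
  · have h1 : 2 * (β / 4) * (Fintype.card X * Fintype.card V₀) ≤
        cnt (fun p : X × V₀ => B p.2 p.1) := by
      rw [cnt_prod_symm fun i (d : V₀) => B d i]
      have : ∀ d ∈ (univ : Finset V₀), β / 2 * x ≤ cnt fun i => B d i := fun d _ =>
        ((mem_filter.1 d.2).2).1
      have := card_nsmul_le_sum univ _ _ this
      rw [nsmul_eq_mul, card_univ] at this
      linarith
    have h2 := cnt_popular (fun i (d : V₀) => B d i) (e := β / 4) (by positivity) h1 (by
      rw [hzc] at hzpos
      rw [Fintype.card_coe]
      exact_mod_cast hzpos)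
    rw [Fintype.card_coe] at h2
    refine h2.trans (le_of_eq ?_)
    rw [← cnt_mem_finset]
    exact cnt_congr fun i => by simp
  · intro v hv i hi
    have hv2 := (mem_filter.1 hv).2
    have hi2 := (mem_filter.1 hi).2
    have h1 : cnt (fun d : V₀ => B d i) ≤ cnt fun d => d ∈ V₀ ∧ B d i :=
      cnt_le_of_injective _ Subtype.val_injective fun d hd => ⟨d.2, hd⟩
    have h2 : cnt (fun d => d ∈ V₀ ∧ B d i) ≤ cnt (fun d => B d i ∧ ¬ few v d) + nb v := by
      refine (cnt_mono fun d hd => ?_).trans (cnt_or_le _ _)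
      by_cases hf : few v d
      · exact Or.inr ⟨hd.1, hf⟩
      · exact Or.inl ⟨hd.2, hf⟩
    have h3 : β ^ 2 / 32 * N ≤ cnt fun d => B d i ∧ ¬ few v d := by
      rw [← hzc] at hi2
      nlinarith
    rw [cnt_prod fun d ξ => B d i ∧ B d ξ ∧ B v ξ]
    refine le_trans ?_ (mul_cnt_le_sum (fun d => B d i ∧ ¬ few v d) _ (c := η * x)
      (fun _ => cnt_nonneg _) fun d hd => (not_lt.1 hd.2).trans
        (cnt_mono fun ξ hξ => ⟨hd.1, hξ.2, hξ.1⟩))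
    have h4 := mul_le_mul_of_nonneg_left h3 (by positivity : 0 ≤ η * x)
    refine le_trans (le_of_eq ?_) h4
    rw [hη]
    ring

end PathCount

section Families

variable {V : Type*} [DecidableEq V]

/-- Greedy choice of representatives with pairwise disjoint supports. -/
lemma exists_disjoint_choice {P Ω : Type*} [Nonempty Ω] (supp : Ω → Finset V)
    (D : P → Ω → Prop) (U₀ : Finset V) (L u : ℕ) (hL : ∀ ω, (supp ω).card ≤ L) (S : Finset P)
    (hu : U₀.card + L * S.card ≤ u)
    (h : ∀ p ∈ S, ∀ U : Finset V, U.card ≤ u → ∃ ω, D p ω ∧ Disjoint (supp ω) U) :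
    ∃ w : P → Ω, (∀ p ∈ S, D p (w p) ∧ Disjoint (supp (w p)) U₀) ∧
      ∀ p ∈ S, ∀ q ∈ S, p ≠ q → Disjoint (supp (w p)) (supp (w q)) := by
  classical
  induction S using Finset.induction_on with
  | empty => exact ⟨fun _ => Classical.arbitrary Ω, by simp⟩
  | insert a S ha ih =>
    rw [card_insert_of_notMem ha] at hu
    obtain ⟨w, hw, hd⟩ := ih (by nlinarith) fun p hp => h p (mem_insert_of_mem hp)
    have hU : (U₀ ∪ S.biUnion fun p => supp (w p)).card ≤ u := by
      refine (card_union_le _ _).trans ?_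
      have := card_biUnion_le_card_mul S (fun p => supp (w p)) L fun p _ => hL _
      nlinarith
    obtain ⟨ω, hω, hdis⟩ := h a (mem_insert_self _ _) _ hU
    rw [disjoint_union_right, disjoint_biUnion_right] at hdis
    have hne : ∀ p ∈ S, p ≠ a := fun p hp hpa => ha (hpa ▸ hp)
    refine ⟨update w a ω, ?_, ?_⟩
    · intro p hp
      rcases mem_insert.1 hp with rfl | hp
      · simpa using ⟨hω, hdis.1⟩
      · simpa [update_of_ne (hne p hp)] using hw p hp
    · intro p hp q hq hpq
      rcases mem_insert.1 hp with rfl | h1 <;> rcases mem_insert.1 hq with rfl | h2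
      · exact absurd rfl hpq
      · simpa [update_of_ne (hne q h2)] using hdis.2 q h2
      · simpa [update_of_ne (hne p h1)] using (hdis.2 p h1).symm
      · simpa [update_of_ne (hne p h1), update_of_ne (hne q h2)] using hd p h1 q h2 hpq

/-- A small family with pairwise disjoint supports which meets each set of a given collection
of dense sets often. -/
lemma exists_rich_family {Ω σ : Type*} [Fintype Ω] [DecidableEq Ω] [Fintype σ]
    (supp : Ω → Finset V) (valid : Ω → Prop) (G : σ → Ω → Prop) (U₀ : Finset V)
    (L T M : ℕ) {γ : ℝ} (hγ : 0 < γ) (hγ1 : γ ≤ 1) (hΩ : 0 < Fintype.card Ω)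
    (hL : ∀ ω, (supp ω).card ≤ L) (hne : ∀ ω, (supp ω).Nonempty)
    (hbad : ∀ U : Finset V, U.card ≤ U₀.card + L * T →
      cnt (fun ω => ¬ valid ω ∨ ¬ Disjoint (supp ω) U) ≤ γ / 2 * Fintype.card Ω)
    (hG : ∀ s, γ * Fintype.card Ω ≤ cnt (G s))
    (hT : Fintype.card σ * (1 - γ / 4) ^ T < (1 / 2 : ℝ) ^ M) :
    ∃ F : Finset Ω, F.card ≤ T ∧ (∀ ω ∈ F, valid ω ∧ Disjoint (supp ω) U₀) ∧
      (∀ ω ∈ F, ∀ ω' ∈ F, ω ≠ ω' → Disjoint (supp ω) (supp ω')) ∧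
      ∀ s, ∃ F' ⊆ F, M < F'.card ∧ ∀ ω ∈ F', G s ω := by
  classical
  have hstep : ∀ j ≤ T, ∃ F : Finset Ω, F.card ≤ j ∧
      (∀ ω ∈ F, valid ω ∧ Disjoint (supp ω) U₀) ∧
      (∀ ω ∈ F, ∀ ω' ∈ F, ω ≠ ω' → Disjoint (supp ω) (supp ω')) ∧
      ∑ s, (1 / 2 : ℝ) ^ (F.filter (G s)).card ≤ Fintype.card σ * (1 - γ / 4) ^ j := by
    intro j hj
    induction j with
    | zero => exact ⟨∅, by simp⟩
    | succ j ih =>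
      obtain ⟨F, hFc, hFv, hFd, hΦ⟩ := ih (by omega)
      rcases isEmpty_or_nonempty σ with hσ | hσ
      · exact ⟨F, by omega, hFv, hFd, by simp⟩
      set φ : σ → ℝ := fun s => (1 / 2 : ℝ) ^ (F.filter (G s)).card with hφ
      have hφ0 : ∀ s, 0 < φ s := fun s => by positivity
      have hΦ0 : 0 < ∑ s, φ s := sum_pos (fun s _ => hφ0 s) univ_nonempty
      set U := U₀ ∪ F.biUnion supp with hU
      have hUc : U.card ≤ U₀.card + L * T := by
        refine (card_union_le _ _).trans ?_
        have := card_biUnion_le_card_mul F supp L fun ω _ => hL ω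
        have : F.card * L ≤ T * L := Nat.mul_le_mul_right _ (by omega)
        nlinarith
      let ok : Ω → Prop := fun ω => valid ω ∧ Disjoint (supp ω) U
      have hok : ∀ s, γ / 2 * Fintype.card Ω ≤ cnt fun ω => G s ω ∧ ok ω := by
        intro s
        have h1 : cnt (G s) ≤ cnt (fun ω => G s ω ∧ ok ω) +
            cnt (fun ω => ¬ valid ω ∨ ¬ Disjoint (supp ω) U) := by
          refine (cnt_mono fun ω hω => ?_).trans (cnt_or_le _ _)
          by_cases h : ok ω
          · exact Or.inl ⟨hω, h⟩
          · exact Or.inr (not_and_or.1 h)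
        have := hG s
        have := hbad U hUc
        linarith
      obtain ⟨ω, -, hω⟩ : ∃ ω ∈ (univ : Finset Ω),
          γ / 2 * ∑ s, φ s ≤ ∑ s, φ s * if G s ω ∧ ok ω then 1 else 0 := by
        refine exists_le_of_sum_le ⟨(Fintype.card_pos_iff.1 hΩ).some, mem_univ _⟩ ?_
        rw [sum_comm, sum_const, card_univ, nsmul_eq_mul, mul_sum, mul_sum]
        refine sum_le_sum fun s _ => ?_
        rw [← mul_sum, ← cnt_eq_sum]
        nlinarith [hok s, hφ0 s]
      have hωok : ok ω := by
        by_contra hno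
        simp only [hno, and_false, if_false, mul_zero, sum_const_zero] at hω
        nlinarith
      have hωU : Disjoint (supp ω) U₀ ∧ ∀ ω' ∈ F, Disjoint (supp ω) (supp ω') := by
        have := hωok.2
        rwa [hU, disjoint_union_right, disjoint_biUnion_right] at this
      have hωF : ω ∉ F := fun hmem =>
        (hne ω).ne_empty (disjoint_self.1 (hωU.2 ω hmem))
      refine ⟨insert ω F, ?_, ?_, ?_, ?_⟩
      · rw [card_insert_of_notMem hωF]; omega
      · intro ω' hω'
        rcases mem_insert.1 hω' with rfl | h
        · exact ⟨hωok.1, hωU.1⟩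
        · exact hFv ω' h
      · intro a ha b hb hab
        rcases mem_insert.1 ha with rfl | h1 <;> rcases mem_insert.1 hb with rfl | h2
        · exact absurd rfl hab
        · exact hωU.2 b h2
        · exact (hωU.2 a h1).symm
        · exact hFd a h1 b h2 hab
      · have e : ∀ s, (1 / 2 : ℝ) ^ ((insert ω F).filter (G s)).card =
            φ s - 1 / 2 * (φ s * if G s ω ∧ ok ω then 1 else 0) := by
          intro s
          rw [filter_insert]
          by_cases h : G s ω
          · rw [if_pos h, card_insert_of_notMem fun hm => hωF (mem_filter.1 hm).1,
              if_pos ⟨h, hωok⟩, pow_succ]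
            simp only [hφ]
            ring
          · simp [h, hφ]
        rw [sum_congr rfl fun s _ => e s, sum_sub_distrib, ← mul_sum, pow_succ]
        have : (∑ s, φ s) * (1 - γ / 4) ≤ Fintype.card σ * (1 - γ / 4) ^ j * (1 - γ / 4) :=
          mul_le_mul_of_nonneg_right hΦ (by linarith)
        nlinarith
  obtain ⟨F, hFc, hFv, hFd, hΦ⟩ := hstep T le_rfl
  refine ⟨F, hFc, hFv, hFd, fun s => ⟨F.filter (G s), filter_subset _ _, ?_,
    fun ω hω => (mem_filter.1 hω).2⟩⟩
  by_contra! hle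
  have h1 : (1 / 2 : ℝ) ^ M ≤ (1 / 2 : ℝ) ^ (F.filter (G s)).card :=
    pow_le_pow_of_le_one (by norm_num) (by norm_num) hle
  have h2 := single_le_sum (f := fun s => (1 / 2 : ℝ) ^ (F.filter (G s)).card)
    (fun s _ => by positivity) (mem_univ s)
  linarith

end Families

section Cycles

variable {n r : ℕ}

/-- `S` can be partitioned into at most `N` monochromatic tight cycles. -/
def Coverable (k : ℕ) (χ : Finset (Fin n) → Fin r) (S : Finset (Fin n)) (N : ℝ) : Prop :=
  ∃ 𝒞 : Finset (Finset (Fin n)), (∀ C ∈ 𝒞, MonoTightCycle k χ C) ∧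
    (𝒞 : Set (Finset (Fin n))).PairwiseDisjoint id ∧ 𝒞.biUnion id = S ∧ (𝒞.card : ℝ) ≤ N

variable {k : ℕ} {χ : Finset (Fin n) → Fin r}

lemma Coverable.mono {S : Finset (Fin n)} {N N' : ℝ} (h : Coverable k χ S N) (hN : N ≤ N') :
    Coverable k χ S N' := by
  obtain ⟨𝒞, h1, h2, h3, h4⟩ := h
  exact ⟨𝒞, h1, h2, h3, h4.trans hN⟩

lemma Coverable.union {S S' : Finset (Fin n)} {N N' : ℝ} (h : Coverable k χ S N)
    (h' : Coverable k χ S' N') (hd : Disjoint S S') : Coverable k χ (S ∪ S') (N + N') := by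
  classical
  obtain ⟨𝒞, h1, h2, h3, h4⟩ := h
  obtain ⟨𝒞', h1', h2', h3', h4'⟩ := h'
  have hsub : ∀ C ∈ 𝒞, C ⊆ S := fun C hC => h3 ▸ subset_biUnion_of_mem id hC
  have hsub' : ∀ C ∈ 𝒞', C ⊆ S' := fun C hC => h3' ▸ subset_biUnion_of_mem id hC
  refine ⟨𝒞 ∪ 𝒞', ?_, ?_, ?_, ?_⟩
  · intro C hC
    rcases mem_union.1 hC with hC | hC
    exacts [h1 C hC, h1' C hC]
  · rw [coe_union]
    refine Set.pairwiseDisjoint_union.2 ⟨h2, h2', fun C hC C' hC' _ => ?_⟩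
    exact disjoint_of_subset_left (hsub C hC) (disjoint_of_subset_right (hsub' C' hC') hd)
  · rw [union_biUnion, h3, h3']
  · have : ((𝒞 ∪ 𝒞').card : ℝ) ≤ 𝒞.card + 𝒞'.card := by exact_mod_cast card_union_le _ _
    linarith

lemma coverable_singletons (hk : 0 < k) (S : Finset (Fin n)) : Coverable k χ S S.card := by
  refine ⟨S.image fun v => {v}, ?_, ?_, ?_, by exact_mod_cast card_image_le⟩
  · intro C hC
    obtain ⟨v, -, rfl⟩ := mem_image.1 hC
    exact Or.inl (by rw [card_singleton]; exact hk)
  · intro C hC C' hC' hne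
    obtain ⟨v, -, rfl⟩ := mem_image.1 (mem_coe.1 hC)
    obtain ⟨v', -, rfl⟩ := mem_image.1 (mem_coe.1 hC')
    simp only [onFun, id, disjoint_singleton]
    rintro rfl
    exact hne rfl
  · ext v; simp

/-- Each edge consisting of `z` and one of `x i`, `y i` for every `i` has colour `c`. -/
def Link {K : ℕ} (χ : Finset (Fin n) → Fin r) (c : Fin r) (z : Fin n) (x y : Fin K → Fin n) :
    Prop :=
  Box (fun t => χ (insert z (univ.image t)) = c) x y

/-- The vertex set of the block with first vertex `z` and remaining vertices `x`. -/
def block {K : ℕ} (z : Fin n) (x : Fin K → Fin n) : Finset (Fin n) :=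
  insert z (univ.image x)

lemma monoTightCycle_of_blocks {K m : ℕ} (hm : 0 < m) (X : ℕ → Fin K → Fin n) (Z : ℕ → Fin n)
    (hX : ∀ q, X (q + m) = X q) (hZ : ∀ q, Z (q + m) = Z q) (c : Fin r)
    (hlink : ∀ q, Link χ c (Z (q + 1)) (X q) (X (q + 1))) (C : Finset (Fin n))
    (hC : C = (range m).biUnion fun q => block (Z q) (X q)) (hcard : C.card = m * (K + 1)) :
    MonoTightCycle (K + 1) χ C := by
  right
  let g : ℕ → Fin n := fun i =>
    (Fin.cons (Z (i / (K + 1))) (X (i / (K + 1))) : Fin (K + 1) → Fin n)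
      ⟨i % (K + 1), Nat.mod_lt _ K.succ_pos⟩
  have hdm : ∀ q p, p < K + 1 → (q * (K + 1) + p) / (K + 1) = q ∧
      (q * (K + 1) + p) % (K + 1) = p := fun q p hp => by
    constructor
    · rw [mul_comm, Nat.mul_add_div K.succ_pos, Nat.div_eq_of_lt hp, add_zero]
    · rw [mul_comm, Nat.mul_add_mod, Nat.mod_eq_of_lt hp]
  have hgZ : ∀ q, g (q * (K + 1)) = Z q := fun q => by
    obtain ⟨h1, h2⟩ := hdm q 0 K.succ_pos
    rw [add_zero] at h1 h2
    simp only [g, h1, h2]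
    exact Fin.cons_zero _ _
  have hgX : ∀ q (j : Fin K), g (q * (K + 1) + 1 + j) = X q j := fun q j => by
    obtain ⟨h1, h2⟩ := hdm q (j + 1) (by omega)
    rw [add_assoc, add_comm 1]
    simp only [g, h1, h2]
    exact Fin.cons_succ (α := fun _ => Fin n) _ _ j
  have hper : ∀ i, g (i + C.card) = g i := fun i => by
    have h1 : (i + m * (K + 1)) / (K + 1) = i / (K + 1) + m :=
      Nat.add_mul_div_right _ _ K.succ_pos
    have h2 : (i + m * (K + 1)) % (K + 1) = i % (K + 1) := Nat.add_mul_mod_self_right _ _ _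
    simp only [hcard, g, h1, h2, hX, hZ]
  have himg : (range C.card).image g = C := by
    ext v
    rw [hcard, hC]
    simp only [block, mem_image, mem_range, mem_biUnion, mem_insert, mem_univ, true_and]
    constructor
    · rintro ⟨i, hi, rfl⟩
      have hq : i / (K + 1) < m := Nat.div_lt_of_lt_mul (by rwa [mul_comm])
      refine ⟨i / (K + 1), hq, ?_⟩
      rcases Nat.eq_zero_or_pos (i % (K + 1)) with h | h
      · left
        rw [← hgZ]
        congr 1
        have := Nat.div_add_mod' i (K + 1)
        omega
      · right
        have hlt : i % (K + 1) < K + 1 := Nat.mod_lt i K.succ_pos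
        refine ⟨⟨i % (K + 1) - 1, by omega⟩, ?_⟩
        rw [← hgX]
        congr 1
        have := Nat.div_add_mod' i (K + 1)
        simp only
        omega
    · rintro ⟨q, hq, rfl | ⟨j, rfl⟩⟩
      · exact ⟨q * (K + 1), Nat.mul_lt_mul_of_pos_right hq K.succ_pos, hgZ q⟩
      · refine ⟨_, ?_, hgX q j⟩
        have := Nat.mul_le_mul_right (K + 1) hq
        have := j.2
        rw [Nat.succ_mul] at *
        omega
  have hwin : ∀ i, χ ((range (K + 1)).image fun j => g (i + 1 + j)) = c := by
    intro i
    set q := i / (K + 1) with hq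
    set b := i % (K + 1) with hb
    have hbK : b < K + 1 := Nat.mod_lt i K.succ_pos
    have hi : i = q * (K + 1) + b := (Nat.div_add_mod' i (K + 1)).symm
    have hq1 : (q + 1) * (K + 1) = q * (K + 1) + (K + 1) := Nat.succ_mul _ _
    have := hlink q fun j => decide (j.1 < b)
    simp only at this
    rw [← this]
    congr 1
    ext v
    simp only [mem_image, mem_range, mem_insert, mem_univ, true_and]
    constructor
    · rintro ⟨j, hj, rfl⟩
      rcases lt_trichotomy (b + j) K with h | h | h
      · right
        refine ⟨⟨b + j, h⟩, ?_⟩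
        have e : i + 1 + j = q * (K + 1) + 1 + (⟨b + j, h⟩ : Fin K) := by simp only; omega
        rw [e, hgX]
        simp
      · left
        rw [← hgZ]
        congr 1
        omega
      · right
        have hlt : b + j - (K + 1) < K := by omega
        refine ⟨⟨b + j - (K + 1), hlt⟩, ?_⟩
        have e : i + 1 + j = (q + 1) * (K + 1) + 1 + (⟨b + j - (K + 1), hlt⟩ : Fin K) := by
          simp only; omega
        rw [e, hgX]
        have : b + j - (K + 1) < b := by omega
        simp [this]
    · rintro (rfl | ⟨j, rfl⟩)
      · refine ⟨K - b, by omega, ?_⟩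
        rw [← hgZ]
        congr 1
        omega
      · have hj := j.2
        rcases lt_or_ge j.1 b with h | h
        · refine ⟨K + 1 + j - b, by omega, ?_⟩
          simp only [h, decide_true, cond_true]
          rw [← hgX]
          congr 1
          omega
        · refine ⟨j - b, by omega, ?_⟩
          simp only [not_lt.2 h, decide_false, cond_false]
          rw [← hgX]
          congr 1
          omega
  refine ⟨g, c, hper, ?_, himg, ?_⟩
  · rw [← coe_range]
    exact card_image_iff.1 (by rw [himg, card_range])
  · intro i
    have hpos : 0 < C.card := by rw [hcard]; positivity
    have := hwin (i + C.card - 1)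
    rw [← this]
    congr 1
    refine image_congr fun j _ => ?_
    rw [← hper]
    congr 1
    omega

end Cycles

section Orbits

variable {n r K : ℕ} {χ : Finset (Fin n) → Fin r} {P : Type*} [DecidableEq P]

lemma monoTightCycle_of_orbit {e : ℕ} (he : 0 < e) (col : P → Fin r) (z : P → ℕ → Fin n)
    (x : P → ℕ → Fin K → Fin n) (nx : P → P) (O : Finset P) (p₀ : P) (hO : 0 < O.card)
    (himg : O = (range O.card).image fun i => nx^[i] p₀) (hper : nx^[O.card] p₀ = p₀)
    (hin : ∀ p ∈ O, ∀ s, s + 1 < e → Link χ (col p) (z p (s + 1)) (x p s) (x p (s + 1)))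
    (hout : ∀ p ∈ O, Link χ (col p) (z (nx p) 0) (x p (e - 1)) (x (nx p) 0))
    (hcol : ∀ p ∈ O, col (nx p) = col p)
    (hcard : ∀ p ∈ O, ((range e).biUnion fun s => block (z p s) (x p s)).card = e * (K + 1))
    (hdisj : (O : Set P).PairwiseDisjoint fun p =>
      (range e).biUnion fun s => block (z p s) (x p s)) :
    MonoTightCycle (K + 1) χ
      (O.biUnion fun p => (range e).biUnion fun s => block (z p s) (x p s)) := by
  have hp : ∀ i, nx^[i + O.card] p₀ = nx^[i] p₀ := fun i => by
    rw [iterate_add_apply, hper]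
  have hmem : ∀ i, nx^[i] p₀ ∈ O := by
    intro i
    induction i using Nat.strong_induction_on with
    | _ i ih =>
      rcases lt_or_ge i O.card with h | h
      · rw [himg]
        exact mem_image_of_mem _ (mem_range.2 h)
      · obtain ⟨j, rfl⟩ := Nat.exists_eq_add_of_le h
        rw [add_comm, hp]
        exact ih j (by omega)
  have hc : ∀ i, col (nx^[i] p₀) = col p₀ := by
    intro i
    induction i with
    | zero => rfl
    | succ i ih => rw [iterate_succ_apply', hcol _ (hmem i), ih]
  have hdiv : ∀ q, (q + O.card * e) / e = q / e + O.card := fun q =>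
    Nat.add_mul_div_right _ _ he
  have hmod : ∀ q, (q + O.card * e) % e = q % e := fun q => Nat.add_mul_mod_self_right _ _ _
  refine monoTightCycle_of_blocks (m := O.card * e) (Nat.mul_pos hO he)
    (fun q => x (nx^[q / e] p₀) (q % e)) (fun q => z (nx^[q / e] p₀) (q % e)) ?_ ?_ (col p₀)
    ?_ _ ?_ ?_
  · intro q; simp only [hdiv, hmod, hp]
  · intro q; simp only [hdiv, hmod, hp]
  · intro q
    have hlt := Nat.mod_lt q he
    have hq := Nat.div_add_mod' q e
    rcases Nat.lt_or_ge (q % e + 1) e with h | h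
    · have e1 : (q + 1) / e = q / e ∧ (q + 1) % e = q % e + 1 :=
        (Nat.div_mod_unique he).2 ⟨by rw [mul_comm e]; omega, h⟩
      simp only [e1]
      rw [← hc (q / e)]
      exact hin _ (hmem _) _ h
    · have e1 : (q + 1) / e = q / e + 1 ∧ (q + 1) % e = 0 :=
        (Nat.div_mod_unique he).2 ⟨by rw [mul_comm e, Nat.succ_mul]; omega, he⟩
      simp only [e1, iterate_succ_apply']
      have e2 : q % e = e - 1 := by omega
      rw [← hc (q / e), e2]
      exact hout _ (hmem _)
  · ext v
    simp only [mem_biUnion, mem_range]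
    constructor
    · rintro ⟨p, hpO, s, hs, hv⟩
      rw [himg] at hpO
      obtain ⟨i, hi, rfl⟩ := mem_image.1 hpO
      have e1 : (i * e + s) / e = i ∧ (i * e + s) % e = s :=
        (Nat.div_mod_unique he).2 ⟨by rw [mul_comm e]; omega, hs⟩
      refine ⟨i * e + s, ?_, by simpa only [e1] using hv⟩
      have := Nat.mul_le_mul_right e (mem_range.1 hi)
      rw [Nat.succ_mul] at this
      omega
    · rintro ⟨q, -, hv⟩
      exact ⟨_, hmem (q / e), q % e, Nat.mod_lt q he, hv⟩
  · rw [card_biUnion hdisj, sum_congr rfl hcard, sum_const, smul_eq_mul, mul_assoc]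

/-- Items consisting of `e` consecutive blocks each, arranged in few orbits of `nx` so that
consecutive items are linked, give a cover by few monochromatic tight cycles. -/
lemma coverable_of_orbits {e : ℕ} (he : 0 < e) (col : P → Fin r) (z : P → ℕ → Fin n)
    (x : P → ℕ → Fin K → Fin n) (nx : P → P) (𝒪 : Finset (Finset P)) (S : Finset P) {a : ℝ}
    (h𝒪 : (𝒪 : Set (Finset P)).PairwiseDisjoint id) (hS : 𝒪.biUnion id = S)
    (ha : (𝒪.card : ℝ) ≤ a)
    (horb : ∀ O ∈ 𝒪, ∃ p, 0 < O.card ∧ O = (range O.card).image (fun i => nx^[i] p) ∧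
      nx^[O.card] p = p)
    (hin : ∀ p ∈ S, ∀ s, s + 1 < e → Link χ (col p) (z p (s + 1)) (x p s) (x p (s + 1)))
    (hout : ∀ p ∈ S, Link χ (col p) (z (nx p) 0) (x p (e - 1)) (x (nx p) 0))
    (hcol : ∀ p ∈ S, col (nx p) = col p)
    (hcard : ∀ p ∈ S, ((range e).biUnion fun s => block (z p s) (x p s)).card = e * (K + 1))
    (hdisj : (S : Set P).PairwiseDisjoint fun p =>
      (range e).biUnion fun s => block (z p s) (x p s)) :
    Coverable (K + 1) χ
      (S.biUnion fun p => (range e).biUnion fun s => block (z p s) (x p s)) a := by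
  classical
  set vs : P → Finset (Fin n) := fun p => (range e).biUnion fun s => block (z p s) (x p s)
  have hsub : ∀ O ∈ 𝒪, O ⊆ S := fun O hO => hS ▸ subset_biUnion_of_mem id hO
  refine ⟨𝒪.image fun O => O.biUnion vs, ?_, ?_, ?_,
    le_trans (by exact_mod_cast card_image_le) ha⟩
  · intro C hC
    obtain ⟨O, hO, rfl⟩ := mem_image.1 hC
    obtain ⟨p, h1, h2, h3⟩ := horb O hO
    have hs := hsub O hO
    exact monoTightCycle_of_orbit he col z x nx O p h1 h2 h3 (fun p hp => hin p (hs hp))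
      (fun p hp => hout p (hs hp)) (fun p hp => hcol p (hs hp)) (fun p hp => hcard p (hs hp))
      (hdisj.subset (coe_subset.2 hs))
  · intro C hC C' hC' hne
    obtain ⟨O, hO, rfl⟩ := mem_image.1 (mem_coe.1 hC)
    obtain ⟨O', hO', rfl⟩ := mem_image.1 (mem_coe.1 hC')
    have hOO : O ≠ O' := fun h => hne (by rw [h])
    simp only [onFun, id]
    rw [disjoint_biUnion_left]
    intro p hp
    rw [disjoint_biUnion_right]
    intro q hq
    refine hdisj (hsub O hO hp) (hsub O' hO' hq) ?_
    rintro rfl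
    exact disjoint_left.1 (h𝒪 hO hO' hOO) hp hq
  · rw [← hS]
    ext v
    simp only [mem_biUnion, mem_image, id]
    constructor
    · rintro ⟨_, ⟨O, hO, rfl⟩, hv⟩
      obtain ⟨p, hp, hv⟩ := mem_biUnion.1 hv
      exact ⟨p, ⟨O, hO, hp⟩, hv⟩
    · rintro ⟨p, ⟨O, hO, hp⟩, hv⟩
      exact ⟨_, ⟨O, hO, rfl⟩, mem_biUnion.2 ⟨p, hp, hv⟩⟩

end Orbits

section Links

variable {n r K : ℕ} {χ : Finset (Fin n) → Fin r}

lemma Link.symm {c : Fin r} {z : Fin n} {x y : Fin K → Fin n} (h : Link χ c z x y) :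
    Link χ c z y x :=
  Box.symm h

/-- A positive proportion of all coloured links is present. -/
lemma link_count {Z W : Type} [Fintype Z] [Fintype W] (χ : Finset (Fin n) → Fin r) (K : ℕ)
    (ζ : Z → Fin n) (φ : W → Fin n) (hr : 0 < r) :
    (1 / r : ℝ) ^ 2 ^ K * ((r * Fintype.card Z) *
      (Fintype.card (Fin K → W) * Fintype.card (Fin K → W))) ≤
    cnt (fun x : (Fin r × Z) × (Fin K → W) × (Fin K → W) =>
      Link χ x.1.1 (ζ x.1.2) (φ ∘ x.2.1) (φ ∘ x.2.2)) := by
  have hr' : (0 : ℝ) < r := by exact_mod_cast hr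
  have h := box_count (W := W) K (A := Fin r × Z)
    (fun a t => χ (insert (ζ a.2) (univ.image (φ ∘ t))) = a.1) (d := 1 / r) (by positivity) (by
      have h1 : cnt (fun _ : Z × (Fin K → W) => True) ≤
          cnt (fun x : (Fin r × Z) × (Fin K → W) =>
            χ (insert (ζ x.1.2) (univ.image (φ ∘ x.2))) = x.1.1) :=
        cnt_le_of_injective
          (fun x => ((χ (insert (ζ x.1) (univ.image (φ ∘ x.2))), x.1), x.2))
          (fun x y hxy => by
            simp only [Prod.mk.injEq] at hxy
            exact Prod.ext hxy.1.2 hxy.2) fun _ _ => rfl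
      refine le_trans (le_of_eq ?_) h1
      rw [cnt_eq_sum]
      simp only [if_true, sum_const, card_univ, nsmul_eq_mul, mul_one, Fintype.card_prod,
        Fintype.card_fin]
      push_cast
      field_simp)
  rw [Fintype.card_prod, Fintype.card_fin] at h
  push_cast at h
  refine h.trans (cnt_mono fun x hx s => ?_)
  have e : (fun i => bif s i then (φ ∘ x.2.2) i else (φ ∘ x.2.1) i) =
      φ ∘ fun i => bif s i then x.2.2 i else x.2.1 i := by
    funext i
    simp only [comp_apply]
    cases s i <;> rfl
  rw [e]
  exact hx s

/-- A dense set of tuples contains an injective tuple avoiding a small set. -/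
lemma exists_injective_of_dense {A ι W V : Type*} [Fintype A] [Fintype ι] [DecidableEq ι]
    [Fintype W] [DecidableEq V] (hA : 0 < Fintype.card A) (φ : W → V) (hφ : Injective φ)
    (D : A × (ι → W) → Prop) {d : ℝ}
    (hd : d * (Fintype.card A * Fintype.card (ι → W)) ≤ cnt D) (U : Finset V)
    (hU : (Fintype.card ι * (Fintype.card ι + U.card) : ℝ) < d * Fintype.card W) :
    ∃ a, D a ∧ Injective a.2 ∧ ∀ i, φ (a.2 i) ∉ U := by
  classical
  have hW : (0 : ℝ) < Fintype.card W := by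
    rcases Nat.eq_zero_or_pos (Fintype.card W) with h | h
    · rw [h] at hU
      have : (0 : ℝ) ≤ Fintype.card ι * (Fintype.card ι + U.card) := by positivity
      simp at hU
      linarith
    · exact_mod_cast h
  have hT : (0 : ℝ) < Fintype.card (ι → W) := by
    have : Nonempty W := Fintype.card_pos_iff.1 (by exact_mod_cast hW)
    exact_mod_cast Fintype.card_pos
  have hA' : (0 : ℝ) < Fintype.card A := by exact_mod_cast hA
  set U' : Finset W := univ.filter fun w => φ w ∈ U with hU'
  have hUc : (U'.card : ℝ) ≤ U.card := by
    exact_mod_cast card_le_card_of_injOn φ (fun w hw => (mem_filter.1 hw).2) hφ.injOn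
  have h1 := cnt_bad_le (ι := ι) U'
  have h2 : cnt (fun a : A × (ι → W) => True ∧ (¬ Injective a.2 ∨ ∃ i, a.2 i ∈ U')) =
      Fintype.card A * cnt fun t : ι → W => ¬ Injective t ∨ ∃ i, t i ∈ U' := by
    rw [cnt_and_prod (fun _ : A => True) fun t : ι → W => ¬ Injective t ∨ ∃ i, t i ∈ U']
    congr 1
    simp [cnt]
  have h3 : cnt (fun t : ι → W => ¬ Injective t ∨ ∃ i, t i ∈ U') <
      d * Fintype.card (ι → W) := by
    refine lt_of_mul_lt_mul_right ?_ hW.le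
    calc _ ≤ _ := h1
      _ ≤ Fintype.card ι * (Fintype.card ι + U.card) * Fintype.card (ι → W) := by gcongr
      _ < d * Fintype.card W * Fintype.card (ι → W) := by gcongr
      _ = _ := by ring
  obtain ⟨a, ha, hna⟩ := exists_of_cnt_lt (p := D)
    (q := fun a : A × (ι → W) => True ∧ (¬ Injective a.2 ∨ ∃ i, a.2 i ∈ U')) (by
      rw [h2]
      refine lt_of_lt_of_le ?_ hd
      nlinarith)
  simp only [true_and, not_or, not_not, not_exists, hU', mem_filter, mem_univ] at hna
  exact ⟨a, ha, hna⟩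

/-- A maximal matching with respect to a relation. -/
lemma exists_maximal_matching {V : Type*} [DecidableEq V] (rel : V → V → Prop)
    (B : Finset V) :
    ∃ (P : Finset (V × V)) (I : Finset V), (∀ p ∈ P, p.1 ≠ p.2 ∧ rel p.1 p.2) ∧
      (∀ b ∈ I, ∀ b' ∈ I, b ≠ b' → ¬ rel b b') ∧
      (P : Set (V × V)).PairwiseDisjoint (fun p => ({p.1, p.2} : Finset V)) ∧
      Disjoint I (P.biUnion fun p => {p.1, p.2}) ∧
      I ∪ (P.biUnion fun p => {p.1, p.2}) = B := by
  induction B using Finset.strongInduction with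
  | H B ih =>
    by_cases h : ∃ b ∈ B, ∃ b' ∈ B, b ≠ b' ∧ rel b b'
    · obtain ⟨b, hb, b', hb', hne, hrel⟩ := h
      have hsub : ({b, b'} : Finset V) ⊆ B := by
        intro v hv
        rcases mem_insert.1 hv with rfl | hv
        · exact hb
        · rwa [mem_singleton.1 hv]
      obtain ⟨P, I, h1, h2, h3, h4, h5⟩ := ih (B \ {b, b'})
        (sdiff_ssubset hsub ⟨b, mem_insert_self _ _⟩)
      have hI : Disjoint ({b, b'} : Finset V) I := by
        refine disjoint_left.2 fun v hv hvI => ?_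
        have : v ∈ B \ {b, b'} := h5 ▸ mem_union_left _ hvI
        exact (mem_sdiff.1 this).2 hv
      have hP : ∀ p ∈ P, Disjoint ({b, b'} : Finset V) {p.1, p.2} := by
        intro p hp
        refine disjoint_left.2 fun v hv hvI => ?_
        have : v ∈ B \ {b, b'} := h5 ▸ mem_union_right _ (mem_biUnion.2 ⟨p, hp, hvI⟩)
        exact (mem_sdiff.1 this).2 hv
      refine ⟨insert (b, b') P, I, ?_, h2, ?_, ?_, ?_⟩
      · intro p hp
        rcases mem_insert.1 hp with rfl | hp
        exacts [⟨hne, hrel⟩, h1 p hp]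
      · rw [coe_insert, Set.pairwiseDisjoint_insert]
        exact ⟨h3, fun p hp _ => hP p hp⟩
      · rw [biUnion_insert, disjoint_union_right]
        exact ⟨hI.symm, h4⟩
      · rw [biUnion_insert, union_left_comm, h5]
        exact union_sdiff_of_subset hsub
    · refine ⟨∅, B, by simp, fun b hb b' hb' hne hrel => h ⟨b, hb, b', hb', hne, hrel⟩,
        by simp, by simp, by simp⟩

end Links

section Cover

lemma exists_cover_of_small {n r K : ℕ} (hr : 0 < r) (χ : Finset (Fin n) → Fin r)
    (B R : Finset (Fin n)) (hBR : Disjoint B R) {δ θ : ℝ} (hδ : δ = (1 / r : ℝ) ^ 2 ^ K)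
    (hθ : θ = δ ^ 2 / (4 * r)) (hR : (K * (K + K * B.card) : ℝ) < θ ^ 2 / 2 * R.card) :
    ∃ R₁ ⊆ R, Coverable (K + 1) χ (B ∪ R₁) (2 / δ + 2 / θ) ∧ R₁.card ≤ K * B.card ∧
      (K * B.card : ℝ) ≤ R₁.card + K * (2 / δ) := by
  classical
  have hr1 : (1 : ℝ) ≤ r := by exact_mod_cast hr
  have hδ0 : 0 < δ := by rw [hδ]; positivity
  have hδ1 : δ ≤ 1 := by
    rw [hδ]
    exact pow_le_one₀ (by positivity) (by rw [div_le_one (by positivity)]; exact hr1)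
  have hθ0 : 0 < θ := by rw [hθ]; positivity
  have hθδ : θ ≤ δ ^ 2 / 4 := by
    rw [hθ]
    exact div_le_div_of_nonneg_left (by positivity) (by norm_num) (by linarith)
  have hδ2 : δ ^ 2 ≤ 1 := pow_le_one₀ hδ0.le hδ1
  have hθ1 : θ ≤ 1 := by linarith
  have hθ2 : θ ^ 2 ≤ θ := by nlinarith
  have hRpos : (0 : ℝ) < R.card := by
    have : (0 : ℝ) ≤ K * (K + K * B.card) := by positivity
    by_contra hc
    have : (R.card : ℝ) = 0 := le_antisymm (not_lt.1 hc) (Nat.cast_nonneg _)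
    rw [this] at hR
    linarith
  have hRc : (Fintype.card R : ℝ) = R.card := by rw [Fintype.card_coe]
  have : Nonempty R := Fintype.card_pos_iff.1 (by
    rw [Fintype.card_coe]; exact_mod_cast hRpos)
  have : Nonempty (Fin r) := ⟨⟨0, hr⟩⟩
  let T := Fin K → R
  have hτ : 0 < Fintype.card T := Fintype.card_pos
  have hτ' : (0 : ℝ) < Fintype.card T := by exact_mod_cast hτ
  let Q : Fin n → Fin r × T × T → Prop := fun b x =>
    Link χ x.1 b (Subtype.val ∘ x.2.1) (Subtype.val ∘ x.2.2)
  have hc3 : (Fintype.card (Fin r × T × T) : ℝ) =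
      r * (Fintype.card T * Fintype.card T) := by
    rw [Fintype.card_prod, Fintype.card_prod, Fintype.card_fin]; push_cast; rfl
  have hc2 : (Fintype.card (Fin r × T) : ℝ) = r * Fintype.card T := by
    rw [Fintype.card_prod, Fintype.card_fin]; push_cast; rfl
  have hQ : ∀ b, δ * Fintype.card (Fin r × T × T) ≤ cnt (Q b) := by
    intro b
    have h := link_count (Z := Unit) χ K (fun _ => b) (Subtype.val : R → Fin n) hr
    rw [← hδ] at h
    refine le_trans (le_of_eq ?_) (h.trans (cnt_le_of_injective
      (fun x => (x.1.1, x.2)) ?_ fun _ h => h))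
    · rw [hc3]; simp [T]
    · rintro ⟨⟨a, _⟩, x⟩ ⟨⟨b, _⟩, y⟩ h
      simpa using h
  obtain ⟨P, I, hP, hI, hPd, hIP, hB⟩ := exists_maximal_matching
    (fun b b' => δ ^ 2 / 2 * Fintype.card (Fin r × T × T) ≤ cnt fun a => Q b a ∧ Q b' a) B
  have hIc : (I.card : ℝ) ≤ 2 / δ := card_le_of_sparse_inter I Q hδ0 hδ1
    (fun b _ => hQ b) fun b hb b' hb' hne => not_le.1 (hI b hb b' hb' hne)
  have hPB : ∀ p ∈ P, ({p.1, p.2} : Finset (Fin n)) ⊆ B := fun p hp v hv =>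
    hB ▸ mem_union_right _ (mem_biUnion.2 ⟨p, hp, hv⟩)
  have hBc : B.card = I.card + 2 * P.card := by
    rw [← hB, card_union_of_disjoint hIP, card_biUnion hPd,
      sum_congr rfl fun p hp => card_pair (hP p hp).1, sum_const, smul_eq_mul, mul_comm]
  let N : Fin n × Fin n → Fin r × T → T → Prop := fun p h t =>
    Q p.1 (h.1, h.2, t) ∧ Q p.2 (h.1, h.2, t)
  let supp : Fin r × T → Finset (Fin n) := fun ω => univ.image (Subtype.val ∘ ω.2)
  have hsuppR : ∀ ω, supp ω ⊆ R := fun ω v hv => by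
    obtain ⟨i, -, rfl⟩ := mem_image.1 hv
    exact (ω.2 i).2
  have hsuppK : ∀ ω, (supp ω).card ≤ K := fun ω => card_image_le.trans (by simp)
  have hchoose : ∀ (D : Fin r × T → Prop) (d : ℝ), θ ^ 2 / 2 ≤ d →
      d * Fintype.card (Fin r × T) ≤ cnt D → ∀ U : Finset (Fin n), U.card ≤ K * B.card →
      ∃ ω, (D ω ∧ Injective ω.2) ∧ Disjoint (supp ω) U := by
    intro D d hd hD U hU
    obtain ⟨ω, h1, h2, h3⟩ := exists_injective_of_dense (A := Fin r) Fintype.card_pos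
      (Subtype.val : R → Fin n) Subtype.val_injective D (d := d) (by
        refine le_trans (le_of_eq ?_) hD
        rw [hc2, Fintype.card_fin]) U (by
        rw [Fintype.card_fin, hRc]
        have hU' : (U.card : ℝ) ≤ K * B.card := by exact_mod_cast hU
        calc (K * (K + U.card) : ℝ) ≤ K * (K + K * B.card) := by gcongr
          _ < _ := hR
          _ ≤ _ := by gcongr)
    refine ⟨ω, ⟨h1, h2⟩, disjoint_left.2 fun v hv hvU => ?_⟩
    obtain ⟨i, -, rfl⟩ := mem_image.1 hv
    exact h3 i hvU
  have hpop : ∀ p ∈ P, δ ^ 2 / 4 * Fintype.card (Fin r × T) ≤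
      cnt fun h => δ ^ 2 / 4 * Fintype.card T ≤ cnt (N p h) := by
    intro p hp
    refine cnt_popular (N p) (by positivity) ?_ hτ
    refine le_trans (le_of_eq ?_) ((hP p hp).2.trans (cnt_le_of_injective
      (fun x => ((x.1, x.2.1), x.2.2)) ?_ fun _ h => h))
    · rw [hc2, hc3]; ring
    · rintro ⟨a, b, c⟩ ⟨a', b', c'⟩ h
      simp only [Prod.mk.injEq] at h ⊢
      tauto
  obtain ⟨hub, hhub, hhubd⟩ := exists_disjoint_choice supp
    (fun p ω => δ ^ 2 / 4 * Fintype.card T ≤ cnt (N p ω) ∧ Injective ω.2) ∅ K (K * B.card)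
    hsuppK P (by rw [card_empty, hBc]; nlinarith [Nat.zero_le (K * P.card)])
    fun p hp U hU => hchoose _ (δ ^ 2 / 4) (by nlinarith) (hpop p hp) U hU
  let NN : Fin n × Fin n → Fin r × T → Prop := fun p a =>
    a.1 = (hub p).1 ∧ N p (hub p) a.2
  have hNN : ∀ p ∈ P, θ * Fintype.card (Fin r × T) ≤ cnt (NN p) := by
    intro p hp
    refine le_trans (le_of_eq ?_) ((hhub p hp).1.1.trans (cnt_le_of_injective
      (fun t => ((hub p).1, t)) (fun _ _ h => by simpa using h) fun _ h => ⟨rfl, h⟩))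
    rw [hc2, hθ]
    field_simp
  obtain ⟨nx, 𝒪, h𝒪, h𝒪P, h𝒪c, horb, hnx⟩ := exists_cycle_cover
    (fun p q => p = q ∨ θ ^ 2 / 2 * Fintype.card (Fin r × T) ≤ cnt fun a => NN p a ∧ NN q a)
    (fun _ => Or.inl rfl) (fun p q h => h.imp Eq.symm fun h =>
      h.trans (cnt_mono fun _ => And.symm)) ⌊2 / θ⌋₊ P (fun J hJ hJi => Nat.le_floor
      (card_le_of_sparse_inter J NN hθ0 hθ1 (fun p hp => hNN p (hJ hp))
        fun p hp q hq hne => not_le.1 fun h => hJi p hp q hq hne (Or.inr h)))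
  have hU₀ : (P.biUnion fun p => supp (hub p)).card ≤ P.card * K :=
    card_biUnion_le_card_mul _ _ _ fun p _ => hsuppK _
  obtain ⟨con, hcon, hcond⟩ := exists_disjoint_choice supp
    (fun p ω => (NN p ω ∧ NN (nx p) ω) ∧ Injective ω.2) (P.biUnion fun p => supp (hub p)) K
    (K * B.card) hsuppK P (by
      rw [hBc]
      nlinarith [Nat.zero_le (K * I.card)])
    fun p hp U hU => hchoose _ (θ ^ 2 / 2) le_rfl (by
      rcases (hnx p hp).1 with h | h
      · rw [← h]
        refine le_trans ?_ ((hNN p hp).trans (cnt_mono fun a h => ⟨h, h⟩))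
        have : θ ^ 2 / 2 ≤ θ := by linarith
        gcongr
      · exact h) U hU
  let z : Fin n × Fin n → ℕ → Fin n := fun p s => if s = 0 then p.1 else p.2
  let x : Fin n × Fin n → ℕ → Fin K → Fin n := fun p s =>
    if s = 0 then Subtype.val ∘ (hub p).2 else Subtype.val ∘ (con p).2
  have hvs : ∀ p, ((range 2).biUnion fun s => block (z p s) (x p s)) =
      {p.1, p.2} ∪ (supp (hub p) ∪ supp (con p)) := by
    intro p
    ext v
    simp only [range_add_one, range_zero, block, mem_biUnion, mem_insert, mem_union,
      mem_singleton, z, x, supp, notMem_empty, or_false, exists_eq_or_imp, exists_eq_left,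
      one_ne_zero, if_false, if_true]
    tauto
  have hdB : ∀ p ∈ P, ∀ ω, Disjoint ({p.1, p.2} : Finset (Fin n)) (supp ω) := fun p hp ω =>
    disjoint_of_subset_left (hPB p hp) (disjoint_of_subset_right (hsuppR ω) hBR)
  have hhc : ∀ p ∈ P, ∀ q ∈ P, Disjoint (supp (hub p)) (supp (con q)) := fun p hp q hq =>
    ((disjoint_biUnion_right _ _ _).1 (hcon q hq).2 p hp).symm
  have hinj : ∀ ω : Fin r × T, Injective ω.2 → (supp ω).card = K := fun ω h => by
    rw [card_image_of_injective _ (Subtype.val_injective.comp h), card_univ, Fintype.card_fin]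
  have hsc : ∀ p ∈ P, (supp (hub p) ∪ supp (con p)).card = 2 * K := fun p hp => by
    rw [card_union_of_disjoint (hhc p hp p hp), hinj _ (hhub p hp).1.2, hinj _ (hcon p hp).1.2,
      two_mul]
  have hsd : (P : Set (Fin n × Fin n)).PairwiseDisjoint fun p =>
      supp (hub p) ∪ supp (con p) := by
    intro p hp q hq hpq
    simp only [onFun, disjoint_union_left, disjoint_union_right]
    exact ⟨⟨hhubd p hp q hq hpq, (hhc q hq p hp).symm⟩, hhc p hp q hq, hcond p hp q hq hpq⟩
  have hcov := coverable_of_orbits (χ := χ) (e := 2) two_pos (fun p => (hub p).1) z x nx 𝒪 P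
    (a := 2 / θ) h𝒪 h𝒪P ((Nat.cast_le.2 h𝒪c).trans (Nat.floor_le (by positivity))) horb
    (by
      intro p hp s hs
      obtain rfl : s = 0 := by omega
      exact (hcon p hp).1.1.1.2.2)
    (by
      intro p hp
      have h1 := (hcon p hp).1.1.2
      have h2 := h1.2.1.symm
      rw [← h1.1.symm.trans (hcon p hp).1.1.1.1]
      exact h2)
    (fun p hp => (hcon p hp).1.1.2.1.symm.trans (hcon p hp).1.1.1.1)
    (by
      intro p hp
      rw [hvs, card_union_of_disjoint, card_pair (hP p hp).1, hsc p hp]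
      · ring
      · exact disjoint_union_right.2 ⟨hdB p hp _, hdB p hp _⟩)
    (by
      intro p hp q hq hpq
      simp only [onFun, hvs]
      exact disjoint_union_left.2 ⟨disjoint_union_right.2 ⟨hPd hp hq hpq,
        disjoint_union_right.2 ⟨hdB p hp _, hdB p hp _⟩⟩, disjoint_union_right.2
        ⟨disjoint_union_left.2 ⟨(hdB q hq _).symm, (hdB q hq _).symm⟩, hsd hp hq hpq⟩⟩)
  have hR₁ : (P.biUnion fun p => supp (hub p) ∪ supp (con p)) ⊆ R :=
    biUnion_subset.2 fun p _ => union_subset (hsuppR _) (hsuppR _)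
  have hR₁c : (P.biUnion fun p => supp (hub p) ∪ supp (con p)).card = P.card * (2 * K) := by
    rw [card_biUnion hsd, sum_congr rfl hsc, sum_const, smul_eq_mul]
  refine ⟨_, hR₁, ?_, ?_, ?_⟩
  · have e : B ∪ (P.biUnion fun p => supp (hub p) ∪ supp (con p)) =
        I ∪ P.biUnion fun p => (range 2).biUnion fun s => block (z p s) (x p s) := by
      rw [← hB]
      simp only [hvs, biUnion_union, union_assoc]
    rw [e]
    refine Coverable.union ((coverable_singletons K.succ_pos I).mono hIc) hcov ?_
    simp only [hvs]
    rw [biUnion_union, disjoint_union_right]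
    refine ⟨hIP, disjoint_of_subset_left ?_ (disjoint_of_subset_right hR₁ hBR)⟩
    rw [← hB]
    exact subset_union_left
  · rw [hR₁c, hBc]
    nlinarith [Nat.zero_le (K * I.card)]
  · rw [hR₁c, hBc]
    push_cast
    have : (K * I.card : ℝ) ≤ K * (2 / δ) := by gcongr
    nlinarith

end Cover

section Contexts

variable {n r K : ℕ}

/-- The positions in a context: three single vertices and three `K`-tuples. -/
abbrev CtxIdx (K : ℕ) : Type := Fin 3 ⊕ Fin 3 × Fin K

/-- The `s`-th tuple of a context. -/
def row (ξ : CtxIdx K → Fin n) (s : Fin 3) : Fin K → Fin n := fun j => ξ (Sum.inr (s, j))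

/-- The vertex `z` can be used as the first vertex of the second block of the context `ξ`. -/
def Fits (χ : Finset (Fin n) → Fin r) (c : Fin r) (z : Fin n) (ξ : CtxIdx K → Fin n) : Prop :=
  Link χ c z (row ξ 0) (row ξ 1) ∧ Link χ c (ξ (Sum.inl 1)) (row ξ 1) (row ξ 2)

/-- The tuple `w` links the end of the context `ξ` to its beginning. -/
def Closes (χ : Finset (Fin n) → Fin r) (c : Fin r) (ξ : CtxIdx K → Fin n) (w : Fin K → Fin n) :
    Prop :=
  Link χ c (ξ (Sum.inl 0)) w (row ξ 0) ∧ Link χ c (ξ (Sum.inl 2)) (row ξ 2) w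

lemma exists_dense_link_colour (hr : 0 < r) (χ : Finset (Fin n) → Fin r) {δ : ℝ}
    (hδ : δ = (1 / r : ℝ) ^ 2 ^ K) :
    ∃ c, δ * (Fintype.card (Fin K → Fin n) *
        Fintype.card (Fin n × (Fin K → Fin n))) ≤
      cnt fun x : (Fin K → Fin n) × (Fin n × (Fin K → Fin n)) => Link χ c x.2.1 x.1 x.2.2 := by
  have h := link_count (Z := Fin n) (W := Fin n) χ K id id hr
  rw [← hδ] at h
  have e : cnt (fun x : (Fin r × Fin n) × (Fin K → Fin n) × (Fin K → Fin n) =>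
      Link χ x.1.1 (id x.1.2) (id ∘ x.2.1) (id ∘ x.2.2)) ≤
      cnt fun y : Fin r × (Fin K → Fin n) × (Fin n × (Fin K → Fin n)) =>
        Link χ y.1 y.2.2.1 y.2.1 y.2.2.2 :=
    cnt_le_of_injective (fun x => (x.1.1, x.2.1, x.1.2, x.2.2)) (by
      rintro ⟨⟨a, b⟩, c, d⟩ ⟨⟨a', b'⟩, c', d'⟩ h
      simp only [Prod.mk.injEq] at h ⊢
      tauto) fun _ h => h
  have h' := h.trans e
  rw [cnt_prod fun c (x : (Fin K → Fin n) × (Fin n × (Fin K → Fin n))) =>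
    Link χ c x.2.1 x.1 x.2.2] at h'
  by_contra! hc
  have hlt := sum_lt_sum_of_nonempty (s := (univ : Finset (Fin r))) ⟨⟨0, hr⟩, mem_univ _⟩
    fun c _ => hc c
  rw [sum_const, card_univ, Fintype.card_fin, nsmul_eq_mul] at hlt
  refine absurd (h'.trans_lt hlt) (not_lt.2 (le_of_eq ?_))
  rw [Fintype.card_prod, Fintype.card_fin]
  push_cast
  ring

/-- In some colour, a positive proportion of vertices and contexts fit together. -/
lemma exists_dense_contexts (hr : 0 < r) (hn : 0 < n) (χ : Finset (Fin n) → Fin r) {δ θ : ℝ}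
    (hδ : δ = (1 / r : ℝ) ^ 2 ^ K) (hθ : θ = δ ^ 4 / 2) :
    ∃ c, θ * (Fintype.card (Fin n) * Fintype.card (CtxIdx K → Fin n)) ≤
      cnt fun p : Fin n × (CtxIdx K → Fin n) => Fits χ c p.1 p.2 ∧
        θ * Fintype.card (Fin K → Fin n) ≤ cnt (Closes χ c p.2) := by
  have hδ0 : 0 < δ := by rw [hδ]; positivity
  have hθ0 : 0 < θ := by rw [hθ]; positivity
  have : Nonempty (Fin n) := ⟨⟨0, hn⟩⟩
  let T := Fin K → Fin n
  obtain ⟨c, hc⟩ := exists_dense_link_colour (K := K) hr χ hδ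
  refine ⟨c, ?_⟩
  have h1 := cnt_clone (fun (y : T) (a : Fin n × T) => Link χ c a.1 y a.2) hδ0.le hc
  let p : (T × T) → (T × Fin n × Fin n) → Prop := fun s a =>
    Link χ c a.2.1 a.1 s.1 ∧ Link χ c a.2.2 a.1 s.2
  have h2 : δ ^ 2 * (Fintype.card (T × T) * Fintype.card (T × Fin n × Fin n)) ≤
      cnt fun x : (T × T) × (T × Fin n × Fin n) => p x.1 x.2 := by
    refine le_trans (le_of_eq ?_) (h1.trans (cnt_le_of_injective
      (fun x => ((x.2.1.2, x.2.2.2), (x.1, x.2.1.1, x.2.2.1))) ?_ fun _ h => h))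
    · simp only [Fintype.card_prod]; push_cast; ring
    · rintro ⟨y, ⟨z, x⟩, z', x'⟩ ⟨y', ⟨z1, x1⟩, z2, x2⟩ h
      simp only [Prod.mk.injEq] at h ⊢
      tauto
  have h3 := cnt_clone p (by positivity) h2
  have hcardX : Fintype.card (CtxIdx K → Fin n) =
      n * n * n * (Fintype.card T * Fintype.card T * Fintype.card T) := by
    simp only [T, Fintype.card_fun, Fintype.card_sum, Fintype.card_prod, Fintype.card_fin]
    ring
  have h4 : 2 * θ * (Fintype.card (Fin n × (CtxIdx K → Fin n)) * Fintype.card T) ≤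
      cnt fun x : (Fin n × (CtxIdx K → Fin n)) × T => Fits χ c x.1.1 x.1.2 ∧
        Closes χ c x.1.2 x.2 := by
    refine le_trans (le_of_eq ?_) (h3.trans (cnt_le_of_injective
      (fun x => ((x.2.1.2.1, Sum.elim ![x.2.2.2.1, x.2.1.2.2, x.2.2.2.2]
        fun i => ![x.1.1, x.2.1.1, x.1.2] i.1 i.2), x.2.2.1)) ?_ ?_))
    · rw [hθ, Fintype.card_prod, hcardX]
      simp only [Fintype.card_prod, Fintype.card_fin]
      push_cast
      ring
    · rintro ⟨⟨x, q⟩, ⟨y, z, z1⟩, w, b, b'⟩ ⟨⟨x', q'⟩, ⟨y', z', z1'⟩, w', a, a'⟩ h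
      simp only [Prod.mk.injEq] at h
      obtain ⟨⟨hz, h⟩, hw⟩ := h
      have e1 := congrFun h (Sum.inl 0)
      have e2 := congrFun h (Sum.inl 1)
      have e3 := congrFun h (Sum.inl 2)
      have e4 : x = x' := funext fun j => congrFun h (Sum.inr (0, j))
      have e5 : y = y' := funext fun j => congrFun h (Sum.inr (1, j))
      have e6 : q = q' := funext fun j => congrFun h (Sum.inr (2, j))
      simp only [Sum.elim_inl, Matrix.cons_val] at e1 e2 e3
      simp [*]
    · rintro ⟨⟨x, q⟩, ⟨y, z, z1⟩, w, b, b'⟩ ⟨⟨h1, h2⟩, h3, h4⟩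
      exact ⟨⟨h1.symm, h2⟩, h3, h4.symm⟩
  refine le_trans (le_of_eq ?_) ((cnt_popular (fun (a : Fin n × (CtxIdx K → Fin n)) (w : T) =>
    Fits χ c a.1 a.2 ∧ Closes χ c a.2 w) hθ0.le h4 Fintype.card_pos).trans
    (cnt_mono fun a h => ⟨?_, h.trans (cnt_mono fun _ h => h.2)⟩))
  · rw [Fintype.card_prod]; push_cast; rfl
  · have : (0 : ℝ) < Fintype.card T := by exact_mod_cast Fintype.card_pos
    obtain ⟨w, hw⟩ := exists_of_cnt_pos ((mul_pos hθ0 this).trans_le h)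
    exact hw.1

end Contexts

section Absorbing

lemma card_mul_pow_lt {M s T : ℕ} {γ : ℝ} (hγ1 : γ ≤ 1) (hs : s ≤ 2 * M * M)
    (hT : (16 * M : ℝ) ≤ γ * T) : (s : ℝ) * (1 - γ / 4) ^ T < (1 / 2 : ℝ) ^ M := by
  rcases Nat.eq_zero_or_pos M with rfl | hM
  · obtain rfl : s = 0 := by omega
    norm_num
  have h1 : (1 - γ / 4) ^ T ≤ (1 / 16 : ℝ) ^ M := by
    calc (1 - γ / 4) ^ T ≤ (Real.exp (-(γ / 4))) ^ T :=
          pow_le_pow_left₀ (by linarith) (by linarith [Real.add_one_le_exp (-(γ / 4))]) T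
      _ = Real.exp (-(γ * T / 4)) := by rw [← Real.exp_nat_mul]; congr 1; ring
      _ ≤ Real.exp (-(4 * M)) := Real.exp_le_exp.2 (by linarith)
      _ = (Real.exp (-4)) ^ M := by rw [← Real.exp_nat_mul]; congr 1; ring
      _ ≤ (1 / 16) ^ M := by
          refine pow_le_pow_left₀ (Real.exp_pos _).le ?_ M
          rw [Real.exp_neg, ← one_div]
          refine one_div_le_one_div_of_le (by norm_num) ?_
          have : (2 : ℝ) ≤ Real.exp 1 := by linarith [Real.add_one_le_exp (1 : ℝ)]
          calc (16 : ℝ) = 2 ^ 4 := by norm_num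
            _ ≤ Real.exp 1 ^ 4 := pow_le_pow_left₀ (by norm_num) this 4
            _ = Real.exp 4 := by rw [← Real.exp_nat_mul]; norm_num
  have h2 : (s : ℝ) < 8 ^ M := by
    have h3 : M < 2 ^ M := Nat.lt_two_pow_self
    have h4 : 2 ≤ 2 ^ M := Nat.le_self_pow hM.ne' 2
    have h5 : s < 8 ^ M := by
      calc s ≤ 2 * M * M := hs
        _ ≤ 2 ^ M * M * M := by gcongr
        _ < 2 ^ M * 2 ^ M * 2 ^ M := by
            have : M * M < 2 ^ M * 2 ^ M := Nat.mul_lt_mul'' h3 h3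
            rw [mul_assoc, mul_assoc]
            exact Nat.mul_lt_mul_of_pos_left this (by positivity)
        _ = 8 ^ M := by rw [← mul_pow, ← mul_pow]; norm_num
    exact_mod_cast h5
  calc (s : ℝ) * (1 - γ / 4) ^ T ≤ s * (1 / 16) ^ M := by gcongr
    _ < 8 ^ M * (1 / 16) ^ M := by gcongr
    _ = (1 / 2) ^ M := by rw [← mul_pow]; norm_num

/-- A set of contexts with pairwise disjoint supports which, for every choice of `M` vertices of
a reservoir `R`, can be matched to these vertices together with a fixed set `D`. -/
lemma exists_absorbing_contexts {V ι : Type} [Fintype V] [DecidableEq V] [Fintype ι]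
    [DecidableEq ι] [Nonempty ι] (B : V → (ι → V) → Prop) {β γ : ℝ} (hβ0 : 0 < β) (hβ1 : β ≤ 1)
    (hγ : γ = β ^ 5 / 4096) (hV : 0 < Fintype.card V)
    (hB : β * (Fintype.card V * Fintype.card (ι → V)) ≤
      cnt fun p : V × (ι → V) => B p.1 p.2) (M N T L : ℕ) (hN : N ≤ M)
    (hT : (16 * M : ℝ) ≤ γ * T) (hL : L = Fintype.card ι + 1)
    (hn : (L * (L + (L * (2 * M) + L * T)) : ℝ) ≤ γ / 2 * Fintype.card V) :
    ∃ (R D : Finset V) (S : Finset (Fin M ⊕ V × (ι → V))) (ctx : Fin M ⊕ V × (ι → V) → ι → V),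
      R.card = M + N ∧ Disjoint R D ∧ D.card ≤ T ∧ S.card ≤ M + T ∧
      (∀ p ∈ S, Injective (ctx p) ∧ Disjoint (univ.image (ctx p)) R ∧
        Disjoint (univ.image (ctx p)) D ∧ ∃ z, B z (ctx p)) ∧
      (∀ p ∈ S, ∀ q ∈ S, p ≠ q → Disjoint (univ.image (ctx p)) (univ.image (ctx q))) ∧
      ∀ R' ⊆ R, R'.card = M → ∃ f : Fin M ⊕ V × (ι → V) → V,
        Set.InjOn f S ∧ S.image f = D ∪ R' ∧ ∀ p ∈ S, B (f p) (ctx p) := by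
  classical
  have hX : 0 < Fintype.card (ι → V) := by
    have : Nonempty V := Fintype.card_pos_iff.1 hV
    exact Fintype.card_pos
  have hV' : (0 : ℝ) < Fintype.card V := by exact_mod_cast hV
  have hγ0 : 0 < γ := by rw [hγ]; positivity
  have hβ5 : β ^ 5 ≤ β := by
    calc β ^ 5 = β * β ^ 4 := by ring
      _ ≤ β * 1 := by gcongr; exact pow_le_one₀ hβ0.le hβ1
      _ = β := mul_one β
  have hγβ : γ ≤ β / 4096 := by rw [hγ]; gcongr
  have hL2 : 2 ≤ L := by rw [hL]; have := Fintype.card_pos (α := ι); omega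
  have hL2' : (2 : ℝ) ≤ L := by exact_mod_cast hL2
  have hN' : (N : ℝ) ≤ M := by exact_mod_cast hN
  have hLι : (L : ℝ) = Fintype.card ι + 1 := by rw [hL]; push_cast; rfl
  have hι0 : (0 : ℝ) ≤ Fintype.card ι := by positivity
  have hM0 : (0 : ℝ) ≤ M := by positivity
  have hT0 : (0 : ℝ) ≤ T := by positivity
  obtain ⟨R₀, Y, hR₀, hY, hpath⟩ := exists_dense_path_sets B hβ0 hV hX hB
  obtain ⟨R, hRR₀, hR⟩ : ∃ R ⊆ R₀, R.card = M + N := by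
    refine exists_subset_card_eq ?_
    have h1 : ((M + N : ℕ) : ℝ) ≤ R₀.card := by
      push_cast
      refine le_trans ?_ hR₀
      have : (2 * M : ℝ) ≤ L * (L + (L * (2 * M) + L * T)) := by
        have h1 : (2 * M : ℝ) ≤ L * (2 * M) := by nlinarith
        have h2 : (0 : ℝ) ≤ L * T := by positivity
        nlinarith
      nlinarith
    exact_mod_cast h1
  have : Nonempty (ι → V) := Fintype.card_pos_iff.1 hX
  have hsι : ∀ ξ : ι → V, (univ.image ξ).card ≤ Fintype.card ι := fun ξ =>
    card_image_le.trans (by rw [card_univ])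
  obtain ⟨w, hw, hwd⟩ := exists_disjoint_choice (fun ξ : ι → V => univ.image ξ)
    (fun (_ : Fin M) ξ => ξ ∈ Y ∧ Injective ξ) R (Fintype.card ι)
    (R.card + Fintype.card ι * M) hsι univ (by simp) (by
      intro _ _ U hU
      obtain ⟨a, h1, h2, h3⟩ := exists_injective_of_dense (A := Unit) (by simp) (id : V → V)
        injective_id (fun a => a.2 ∈ Y) (d := β / 4) (by
          refine le_trans (le_of_eq ?_) (hY.trans ((cnt_mem_finset Y).symm.le.trans
            (cnt_le_of_injective (fun ξ => ((), ξ)) (fun _ _ h => by simpa using h)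
              fun _ h => h)))
          simp) U (by
          have hU' : (U.card : ℝ) ≤ M + N + Fintype.card ι * M := by
            rw [hR] at hU; exact_mod_cast hU
          have hU2 : (U.card : ℝ) ≤ L * (2 * M) + L * T := by nlinarith [mul_nonneg hT0 hι0]
          have h3 : (Fintype.card ι : ℝ) ≤ L := by linarith
          calc (Fintype.card ι * (Fintype.card ι + U.card) : ℝ)
              ≤ L * (L + (L * (2 * M) + L * T)) := by gcongr
            _ ≤ γ / 2 * Fintype.card V := hn
            _ < β / 4 * Fintype.card V := by
                refine mul_lt_mul_of_pos_right ?_ hV'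
                linarith)
      refine ⟨a.2, ⟨h1, h2⟩, disjoint_left.2 fun v hv hvU => ?_⟩
      obtain ⟨i, -, rfl⟩ := mem_image.1 hv
      exact h3 i hvU)
  set U₀ := R ∪ univ.biUnion fun i => univ.image (w i) with hU₀
  have hU₀c : (U₀.card : ℝ) ≤ L * (2 * M) := by
    have h1 : (U₀.card : ℝ) ≤ (M + N) + M * Fintype.card ι := by
      have h2 := card_union_le R (univ.biUnion fun i => univ.image (w i))
      have h3 := card_biUnion_le_card_mul univ (fun i => univ.image (w i)) _ fun i _ => hsι (w i)
      rw [card_univ, Fintype.card_fin] at h3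
      rw [hR] at h2
      exact_mod_cast h2.trans (Nat.add_le_add_left h3 _)
    nlinarith
  let supp : V × (ι → V) → Finset V := fun ω => insert ω.1 (univ.image ω.2)
  let e : V × (ι → V) → Option ι → V := fun ω o => o.elim ω.1 ω.2
  have he : Injective e := by
    rintro ⟨d, ξ⟩ ⟨d', ξ'⟩ h
    have h1 : d = d' := congrFun h none
    have h2 : ξ = ξ' := funext fun i => congrFun h (some i)
    rw [h1, h2]
  obtain ⟨F₀, hF₀c, hF₀v, hF₀d, hF₀⟩ := exists_rich_family supp (fun ω => Injective (e ω))
    (fun (s : R × Fin M) ω => B ω.1 (w s.2) ∧ B ω.1 ω.2 ∧ B s.1 ω.2) U₀ L T M hγ0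
    (by linarith) (by rw [Fintype.card_prod]; positivity)
    (fun ω => (card_insert_le _ _).trans (by rw [hL]; exact Nat.succ_le_succ (hsι _)))
    (fun ω => insert_nonempty _ _) (by
      intro U hU
      have hU' : (U.card : ℝ) ≤ L * (2 * M) + L * T := by
        have : (U.card : ℝ) ≤ U₀.card + L * T := by exact_mod_cast hU
        linarith
      have h1 := cnt_bad_le (ι := Option ι) U
      rw [Fintype.card_option] at h1
      have hcard : (Fintype.card (Option ι → V) : ℝ) = Fintype.card (V × (ι → V)) := by
        rw [Fintype.card_prod, Fintype.card_fun, Fintype.card_fun, Fintype.card_option, pow_succ,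
          mul_comm]
      rw [hcard] at h1
      push_cast at h1
      rw [← hLι] at h1
      have h2 : cnt (fun ω => ¬ Injective (e ω) ∨ ¬ Disjoint (supp ω) U) ≤
          cnt fun t : Option ι → V => ¬ Injective t ∨ ∃ i, t i ∈ U := by
        refine cnt_le_of_injective e he fun ω h => h.imp_right fun h => ?_
        obtain ⟨v, hv, hvU⟩ := not_disjoint_iff.1 h
        rcases mem_insert.1 hv with rfl | hv
        · exact ⟨none, hvU⟩
        · obtain ⟨i, -, rfl⟩ := mem_image.1 hv
          exact ⟨some i, hvU⟩
      refine le_of_mul_le_mul_right ?_ hV'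
      calc _ ≤ _ := mul_le_mul_of_nonneg_right h2 hV'.le
        _ ≤ _ := h1
        _ ≤ (L * (L + (L * (2 * M) + L * T))) * Fintype.card (V × (ι → V)) := by gcongr
        _ ≤ (γ / 2 * Fintype.card V) * Fintype.card (V × (ι → V)) := by gcongr
        _ = _ := by ring)
    (by
      rintro ⟨v, i⟩
      have h1 := hpath v (hRR₀ v.2) (w i) (hw i (mem_univ _)).1.1
      rw [← hγ] at h1
      rw [Fintype.card_prod]
      push_cast
      exact h1)
    (card_mul_pow_lt (by linarith) (by
      rw [Fintype.card_prod, Fintype.card_coe, Fintype.card_fin, hR]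
      gcongr
      omega) hT)
  let F := F₀.filter fun ω => B ω.1 ω.2
  have hFF₀ : F ⊆ F₀ := filter_subset _ _
  have hFd : ∀ ω ∈ F, ∀ ω' ∈ F, ω ≠ ω' → Disjoint (supp ω) (supp ω') := fun ω h ω' h' =>
    hF₀d ω (hFF₀ h) ω' (hFF₀ h')
  have hFU : ∀ ω ∈ F, Disjoint (supp ω) U₀ := fun ω h => (hF₀v ω (hFF₀ h)).2
  have hFB : ∀ ω ∈ F, B ω.1 ω.2 := fun ω h => (mem_filter.1 h).2
  have hfst : Set.InjOn Prod.fst (F : Set (V × (ι → V))) := by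
    intro ω h ω' h' hωω'
    by_contra hne
    exact disjoint_left.1 (hFd ω h ω' h' hne) (mem_insert_self _ _)
      (hωω' ▸ mem_insert_self _ _)
  have hRU : R ⊆ U₀ := subset_union_left
  have hwU : ∀ i, univ.image (w i) ⊆ U₀ := fun i v hv =>
    mem_union_right _ (mem_biUnion.2 ⟨i, mem_univ _, hv⟩)
  have hsub : ∀ ω : V × (ι → V), univ.image ω.2 ⊆ supp ω := fun ω => subset_insert _ _
  have hRD : Disjoint R (F.image Prod.fst) := by
    refine disjoint_left.2 fun v hv hvD => ?_
    obtain ⟨ω, hω, rfl⟩ := mem_image.1 hvD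
    exact disjoint_left.1 (hFU ω hω) (mem_insert_self _ _) (hRU hv)
  have hmemS : ∀ p : Fin M ⊕ V × (ι → V), p ∈ (univ : Finset (Fin M)).disjSum F ↔
      (∃ i, p = Sum.inl i) ∨ ∃ ω ∈ F, p = Sum.inr ω := by
    intro p
    rw [mem_disjSum]
    simp [eq_comm]
  refine ⟨R, F.image Prod.fst, univ.disjSum F, Sum.elim w Prod.snd, hR, hRD,
    card_image_le.trans ((card_le_card hFF₀).trans hF₀c), ?_, ?_, ?_, ?_⟩
  · rw [card_disjSum, card_univ, Fintype.card_fin]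
    exact Nat.add_le_add_left ((card_le_card hFF₀).trans hF₀c) _
  · intro p hp
    rcases (hmemS p).1 hp with ⟨i, rfl⟩ | ⟨ω, hω, rfl⟩
    · have hRpos : 0 < R.card := by have := i.pos; omega
      obtain ⟨v, hv⟩ := card_pos.1 hRpos
      obtain ⟨F', hF', hMF', hG⟩ := hF₀ (⟨v, hv⟩, i)
      obtain ⟨ω, hω⟩ := card_pos.1 (M.zero_le.trans_lt hMF')
      refine ⟨(hw i (mem_univ _)).1.2, (hw i (mem_univ _)).2, ?_, ω.1, (hG ω hω).1⟩
      refine disjoint_right.2 fun v hv hvi => ?_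
      obtain ⟨ω, hω, rfl⟩ := mem_image.1 hv
      exact disjoint_left.1 (hFU ω hω) (mem_insert_self _ _) (hwU i hvi)
    · have hinj := (hF₀v ω (hFF₀ hω)).1
      refine ⟨fun i j hij => Option.some_injective _ (hinj (a₁ := some i) (a₂ := some j) hij),
        disjoint_of_subset_left (hsub ω) (disjoint_of_subset_right hRU (hFU ω hω)), ?_,
        ω.1, hFB ω hω⟩
      refine disjoint_right.2 fun v hv hvi => ?_
      obtain ⟨ω', hω', rfl⟩ := mem_image.1 hv
      by_cases h : ω = ω'
      · subst h
        obtain ⟨i, -, hi⟩ := mem_image.1 hvi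
        exact Option.some_ne_none i (hinj (a₁ := some i) (a₂ := none) hi)
      · exact disjoint_left.1 (hFd ω hω ω' hω' h) (hsub ω hvi) (mem_insert_self _ _)
  · have hwF : ∀ i, ∀ ω ∈ F, Disjoint (univ.image (w i)) (univ.image ω.2) := fun i ω hω =>
      (disjoint_of_subset_left (hsub ω) (disjoint_of_subset_right (hwU i) (hFU ω hω))).symm
    intro p hp q hq hpq
    rcases (hmemS p).1 hp with ⟨i, rfl⟩ | ⟨ω, hω, rfl⟩ <;>
      rcases (hmemS q).1 hq with ⟨j, rfl⟩ | ⟨ω', hω', rfl⟩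
    · exact hwd i (mem_univ _) j (mem_univ _) fun h => hpq (h ▸ rfl)
    · exact hwF i ω' hω'
    · exact (hwF j ω hω).symm
    · exact disjoint_of_subset_left (hsub ω) (disjoint_of_subset_right (hsub ω')
        (hFd ω hω ω' hω' fun h => hpq (h ▸ rfl)))
  · intro R' hR' hR'c
    have : Nonempty (V × (ι → V)) := ⟨(Classical.choice (Fintype.card_pos_iff.1 hV),
      Classical.choice ‹_›)⟩
    let φ : Fin M ≃ R' := Fintype.equivOfCardEq (by rw [Fintype.card_fin, Fintype.card_coe, hR'c])
    obtain ⟨sel, hsel, hseld⟩ := exists_disjoint_choice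
      (fun ω : V × (ι → V) => ({ω} : Finset (V × (ι → V))))
      (fun (i : Fin M) ω => ω ∈ F ∧ B ω.1 (w i) ∧ B (φ i) ω.2) ∅ 1 M (by simp) univ (by simp)
      (by
        intro i _ U hU
        obtain ⟨F', hF', hMF', hG⟩ := hF₀ (⟨φ i, hR' (φ i).2⟩, i)
        obtain ⟨ω, hω, hωU⟩ := exists_mem_notMem_of_card_lt_card (hU.trans_lt hMF')
        exact ⟨ω, ⟨mem_filter.2 ⟨hF' hω, (hG ω hω).2.1⟩, (hG ω hω).1, (hG ω hω).2.2⟩,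
          disjoint_singleton_left.2 hωU⟩)
    have hselinj : Injective sel := fun i j hij => by
      by_contra hne
      exact disjoint_left.1 (hseld i (mem_univ _) j (mem_univ _) hne) (mem_singleton_self _)
        (hij ▸ mem_singleton_self _)
    replace hsel := fun i => (hsel i (mem_univ _)).1
    let f : Fin M ⊕ V × (ι → V) → V := Sum.elim (fun i => (sel i).1)
      fun ω => if h : ∃ i, sel i = ω then φ h.choose else ω.1
    have hf₁ : ∀ i, f (Sum.inr (sel i)) = φ i := fun i => by
      have h : ∃ j, sel j = sel i := ⟨i, rfl⟩
      simp only [f, Sum.elim_inr, dif_pos h]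
      rw [hselinj h.choose_spec]
    have hf₂ : ∀ ω, (¬ ∃ i, sel i = ω) → f (Sum.inr ω) = ω.1 := fun ω h => by
      simp only [f, Sum.elim_inr, dif_neg h]
    have himg : (univ.disjSum F).image f = F.image Prod.fst ∪ R' := by
      ext v
      simp only [mem_image, mem_union, hmemS]
      constructor
      · rintro ⟨_, ⟨i, rfl⟩ | ⟨ω, hω, rfl⟩, rfl⟩
        · exact Or.inl ⟨sel i, (hsel i).1, rfl⟩
        · by_cases h : ∃ i, sel i = ω
          · obtain ⟨i, rfl⟩ := h
            exact Or.inr (hf₁ i ▸ (φ i).2)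
          · exact Or.inl ⟨ω, hω, (hf₂ ω h).symm⟩
      · rintro (⟨ω, hω, rfl⟩ | hv)
        · by_cases h : ∃ i, sel i = ω
          · obtain ⟨i, rfl⟩ := h
            exact ⟨_, Or.inl ⟨i, rfl⟩, rfl⟩
          · exact ⟨_, Or.inr ⟨ω, hω, rfl⟩, hf₂ ω h⟩
        · refine ⟨_, Or.inr ⟨sel (φ.symm ⟨v, hv⟩), (hsel _).1, rfl⟩, ?_⟩
          rw [hf₁, Equiv.apply_symm_apply]
    refine ⟨f, ?_, himg, ?_⟩
    · refine card_image_iff.1 ?_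
      rw [himg, card_union_of_disjoint (disjoint_of_subset_right hR' hRD.symm),
        card_image_of_injOn hfst, hR'c, card_disjSum, card_univ, Fintype.card_fin, add_comm]
    · intro p hp
      rcases (hmemS p).1 hp with ⟨i, rfl⟩ | ⟨ω, hω, rfl⟩
      · exact (hsel i).2.1
      · by_cases h : ∃ i, sel i = ω
        · obtain ⟨i, rfl⟩ := h
          rw [hf₁]
          exact (hsel i).2.2
        · rw [hf₂ ω h]
          exact hFB ω hω

end Absorbing

section Absorber

lemma biUnion_context_blocks {n K : ℕ} (ξ : CtxIdx K → Fin n) (a : Fin n) (w : Fin K → Fin n) :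
    ((range 4).biUnion fun s => block
      (if s = 0 then ξ (Sum.inl 0) else if s = 1 then a else
        if s = 2 then ξ (Sum.inl 1) else ξ (Sum.inl 2))
      (if s = 0 then row ξ 0 else if s = 1 then row ξ 1 else if s = 2 then row ξ 2 else w)) =
      {a} ∪ (univ.image ξ ∪ univ.image w) := by
  ext v
  have e : v ∈ univ.image ξ ↔ ((ξ (Sum.inl 0) = v ∨ ξ (Sum.inl 1) = v ∨ ξ (Sum.inl 2) = v) ∨
      (v ∈ univ.image (row ξ 0) ∨ v ∈ univ.image (row ξ 1) ∨ v ∈ univ.image (row ξ 2))) := by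
    simp [row, Fin.exists_fin_succ]
  rw [mem_union, mem_union, mem_singleton, e]
  have e' : range 4 = {0, 1, 2, 3} := by decide
  simp only [e', block, mem_biUnion, mem_insert, mem_singleton, exists_eq_or_imp, exists_eq_left]
  simp only [one_ne_zero, OfNat.ofNat_ne_zero, OfNat.ofNat_ne_one, if_true, if_false,
    Nat.reduceEqDiff, eq_comm (a := v)]
  constructor
  · rintro ((h | h) | (h | h) | (h | h) | h | h) <;> simp only [h, true_or, or_true]
  · rintro (h | ((h | h | h) | h | h | h) | h) <;> simp only [h, true_or, or_true]

/-- There are disjoint sets `A` and `R` such that `A` together with any `M` vertices of `R` can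
be covered by few monochromatic tight cycles. -/
lemma exists_absorber {n r K : ℕ} (hr : 0 < r) (hn : 0 < n) (χ : Finset (Fin n) → Fin r)
    {δ θ γ : ℝ} (hδ : δ = (1 / r : ℝ) ^ 2 ^ K) (hθ : θ = δ ^ 4 / 2) (hγ : γ = θ ^ 5 / 4096)
    (M N T L : ℕ) (hN : N ≤ M) (hT : (16 * M : ℝ) ≤ γ * T) (hL : L = 4 * K + 4)
    (hL' : (L * (L + (L * (2 * M) + L * T)) : ℝ) ≤ γ / 2 * n) :
    ∃ A R : Finset (Fin n), Disjoint A R ∧ R.card = M + N ∧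
      ∀ R' ⊆ R, R'.card = M → Coverable (K + 1) χ (A ∪ R') (2 / θ) := by
  classical
  have hr1 : (1 : ℝ) ≤ r := by exact_mod_cast hr
  have hδ0 : 0 < δ := by rw [hδ]; positivity
  have hδ1 : δ ≤ 1 := by
    rw [hδ]
    exact pow_le_one₀ (by positivity) (by rw [div_le_one (by positivity)]; exact hr1)
  have hθ0 : 0 < θ := by rw [hθ]; positivity
  have hθ1 : θ ≤ 1 / 2 := by
    have : δ ^ 4 ≤ 1 := pow_le_one₀ hδ0.le hδ1
    linarith
  have hθ5 : θ ^ 5 ≤ θ ^ 2 := pow_le_pow_of_le_one hθ0.le (by linarith) (by norm_num)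
  have hγ0 : 0 < γ := by rw [hγ]; positivity
  have hγθ : γ ≤ θ ^ 2 / 4096 := by rw [hγ]; gcongr
  have hn0 : (0 : ℝ) < n := by exact_mod_cast hn
  obtain ⟨c, hc⟩ := exists_dense_contexts (K := K) hr hn χ hδ hθ
  set ι := CtxIdx K with hι
  set X := ι → Fin n with hXdef
  have hιc : Fintype.card ι = 3 * K + 3 := by
    simp only [hι, Fintype.card_sum, Fintype.card_prod, Fintype.card_fin]; ring
  obtain ⟨R, D, S, ctx, hR, hRD, hD, hS, hctx, hctxd, habs⟩ := exists_absorbing_contexts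
    (fun z ξ => Fits χ c z ξ ∧ θ * Fintype.card (Fin K → Fin n) ≤ cnt (Closes χ c ξ)) hθ0
    (by linarith) hγ (by rwa [Fintype.card_fin]) hc M N T (3 * K + 4) hN hT
    (by rw [hιc]) (by
      rw [Fintype.card_fin]
      have : ((3 * K + 4 : ℕ) : ℝ) ≤ L := by rw [hL]; exact_mod_cast (by omega)
      refine le_trans ?_ hL'
      gcongr)
  have hdense : ∀ p ∈ S, θ * Fintype.card (Fin K → Fin n) ≤ cnt (Closes χ c (ctx p)) :=
    fun p hp => by
      obtain ⟨z, hz⟩ := (hctx p hp).2.2.2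
      exact hz.2
  obtain ⟨nx, 𝒪, h𝒪, h𝒪S, h𝒪c, horb, hnx⟩ := exists_cycle_cover
    (fun p q => p = q ∨ θ ^ 2 / 2 * Fintype.card (Fin K → Fin n) ≤
      cnt fun w => Closes χ c (ctx p) w ∧ Closes χ c (ctx q) w)
    (fun _ => Or.inl rfl) (fun p q h => h.imp Eq.symm fun h =>
      h.trans (cnt_mono fun _ => And.symm)) ⌊2 / θ⌋₊ S (fun J hJ hJi => Nat.le_floor
      (card_le_of_sparse_inter J (fun p => Closes χ c (ctx p)) hθ0 (by linarith)
        (fun p hp => hdense p (hJ hp))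
        fun p hp q hq hne => not_le.1 fun h => hJi p hp q hq hne (Or.inr h)))
  set cs := fun p => (univ : Finset ι).image (ctx p) with hcs
  set U₀ := R ∪ (D ∪ S.biUnion cs) with hU₀
  have hcsc : ∀ p, (cs p).card ≤ 3 * K + 3 := fun p => card_image_le.trans (by rw [card_univ, hιc])
  have hU₀c : U₀.card ≤ (M + N) + (T + (M + T) * (3 * K + 3)) := by
    have h1 := card_biUnion_le_card_mul S cs _ fun p _ => hcsc p
    have h2 : S.card * (3 * K + 3) ≤ (M + T) * (3 * K + 3) := Nat.mul_le_mul_right _ hS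
    exact (card_union_le _ _).trans (Nat.add_le_add hR.le
      ((card_union_le _ _).trans (Nat.add_le_add hD (h1.trans h2))))
  have : Nonempty (Fin K → Fin n) := ⟨fun _ => ⟨0, hn⟩⟩
  obtain ⟨con, hcon, hcond⟩ := exists_disjoint_choice
    (fun w : Fin K → Fin n => univ.image w)
    (fun p w => (Closes χ c (ctx p) w ∧ Closes χ c (ctx (nx p)) w) ∧ Injective w) U₀ K
    (L * (2 * M) + L * T) (fun w => card_image_le.trans (by simp)) S (by
      have : K * S.card ≤ K * (M + T) := Nat.mul_le_mul_left _ hS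
      rw [hL]
      nlinarith [Nat.zero_le (K * M), Nat.zero_le M]) (by
      intro p hp U hU
      have hd : θ ^ 2 / 2 * Fintype.card (Fin K → Fin n) ≤
          cnt fun w => Closes χ c (ctx p) w ∧ Closes χ c (ctx (nx p)) w := by
        rcases (hnx p hp).1 with h | h
        · rw [← h]
          refine le_trans ?_ ((hdense p hp).trans (cnt_mono fun a h => ⟨h, h⟩))
          have : θ ^ 2 / 2 ≤ θ := by nlinarith
          gcongr
        · exact h
      obtain ⟨a, h1, h2, h3⟩ := exists_injective_of_dense (A := Unit) (by simp)
        (id : Fin n → Fin n) injective_id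
        (fun a => Closes χ c (ctx p) a.2 ∧ Closes χ c (ctx (nx p)) a.2) (d := θ ^ 2 / 2) (by
          refine le_trans (le_of_eq (by simp)) (hd.trans
            (cnt_le_of_injective (fun ξ => ((), ξ)) (fun _ _ h => by simpa using h)
              fun _ h => h))) U (by
          have hU' : (U.card : ℝ) ≤ L * (2 * M) + L * T := by exact_mod_cast hU
          have hKL : (K : ℝ) ≤ L := by rw [hL]; exact_mod_cast (by omega)
          rw [Fintype.card_fin, Fintype.card_fin]
          calc (K * (K + U.card) : ℝ) ≤ L * (L + (L * (2 * M) + L * T)) := by gcongr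
            _ ≤ γ / 2 * n := hL'
            _ < θ ^ 2 / 2 * n := by
                refine mul_lt_mul_of_pos_right ?_ hn0
                nlinarith)
      refine ⟨a.2, ⟨h1, h2⟩, disjoint_left.2 fun v hv hvU => ?_⟩
      obtain ⟨i, -, rfl⟩ := mem_image.1 hv
      exact h3 i hvU)
  set ws := fun p => (univ : Finset (Fin K)).image (con p) with hws
  have hRU : R ⊆ U₀ := subset_union_left
  have hDU : D ⊆ U₀ := subset_union_left.trans subset_union_right
  have hcsU : ∀ p ∈ S, cs p ⊆ U₀ := fun p hp =>
    (subset_biUnion_of_mem cs hp).trans (subset_union_right.trans subset_union_right)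
  have hwU : ∀ p ∈ S, Disjoint (ws p) U₀ := fun p hp => (hcon p hp).2
  have hcw : ∀ p ∈ S, ∀ q ∈ S, Disjoint (cs p) (ws q) := fun p hp q hq =>
    disjoint_of_subset_left (hcsU p hp) (hwU q hq).symm
  have hcwc : ∀ p ∈ S, (cs p ∪ ws p).card = 4 * K + 3 := fun p hp => by
    rw [card_union_of_disjoint (hcw p hp p hp), card_image_of_injective _ (hctx p hp).1,
      card_image_of_injective _ (hcon p hp).1.2, card_univ, card_univ, hιc, Fintype.card_fin]
    ring
  have hcwR : ∀ p ∈ S, Disjoint (cs p ∪ ws p) R := fun p hp =>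
    disjoint_union_left.2 ⟨(hctx p hp).2.1, disjoint_of_subset_right hRU (hwU p hp)⟩
  have hcwD : ∀ p ∈ S, Disjoint (cs p ∪ ws p) D := fun p hp =>
    disjoint_union_left.2 ⟨(hctx p hp).2.2.1, disjoint_of_subset_right hDU (hwU p hp)⟩
  refine ⟨D ∪ S.biUnion fun p => cs p ∪ ws p, R, disjoint_union_left.2 ⟨hRD.symm,
    (disjoint_biUnion_left _ _ _).2 hcwR⟩, hR, fun R' hR' hR'c => ?_⟩
  obtain ⟨f, hfinj, hfimg, hf⟩ := habs R' hR' hR'c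
  let z : Fin M ⊕ Fin n × X → ℕ → Fin n := fun p s =>
    if s = 0 then ctx p (Sum.inl 0) else if s = 1 then f p else
      if s = 2 then ctx p (Sum.inl 1) else ctx p (Sum.inl 2)
  let x : Fin M ⊕ Fin n × X → ℕ → Fin K → Fin n := fun p s =>
    if s = 0 then row (ctx p) 0 else if s = 1 then row (ctx p) 1 else
      if s = 2 then row (ctx p) 2 else con p
  have hvs : ∀ p, ((range 4).biUnion fun s => block (z p s) (x p s)) =
      {f p} ∪ (cs p ∪ ws p) :=
    fun p => biUnion_context_blocks (ctx p) (f p) (con p)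
  have hfm : ∀ p ∈ S, f p ∈ D ∪ R' := fun p hp => hfimg ▸ mem_image_of_mem f hp
  have hfd : ∀ p ∈ S, ∀ q ∈ S, Disjoint {f p} (cs q ∪ ws q) := fun p hp q hq =>
    disjoint_of_subset_left (singleton_subset_iff.2 (hfm p hp)) (disjoint_union_left.2
      ⟨(hcwD q hq).symm, disjoint_of_subset_left hR' (hcwR q hq).symm⟩)
  have hcov := coverable_of_orbits (χ := χ) (e := 4) (by norm_num) (fun _ => c) z x nx 𝒪 S
    (a := 2 / θ) h𝒪 h𝒪S ((Nat.cast_le.2 h𝒪c).trans (Nat.floor_le (by positivity))) horb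
    (by
      intro p hp s hs
      obtain rfl | rfl | rfl : s = 0 ∨ s = 1 ∨ s = 2 := by omega
      · exact (hf p hp).1.1
      · exact (hf p hp).1.2
      · exact (hcon p hp).1.1.1.2)
    (fun p hp => (hcon p hp).1.1.2.1)
    (fun _ _ => rfl)
    (by
      intro p hp
      rw [hvs, card_union_of_disjoint (hfd p hp p hp), card_singleton, hcwc p hp]
      ring)
    (by
      intro p hp q hq hpq
      simp only [onFun, hvs]
      exact disjoint_union_left.2 ⟨disjoint_union_right.2
        ⟨disjoint_singleton.2 fun h => hpq (hfinj hp hq h), hfd p hp q hq⟩,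
        disjoint_union_right.2 ⟨(hfd q hq p hp).symm, disjoint_union_left.2
          ⟨disjoint_union_right.2 ⟨hctxd p hp q hq hpq, hcw p hp q hq⟩,
            disjoint_union_right.2 ⟨(hcw q hq p hp).symm, hcond p hp q hq hpq⟩⟩⟩⟩)
  have e : D ∪ (S.biUnion fun p => cs p ∪ ws p) ∪ R' =
      S.biUnion fun p => (range 4).biUnion fun s => block (z p s) (x p s) := by
    rw [union_right_comm, ← hfimg, ← biUnion_singleton, ← biUnion_union]
    exact biUnion_congr rfl fun p _ => (hvs p).symm
  rw [e]
  exact hcov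

end Absorber

section Quantitative

variable {n r K X : ℕ}

lemma sixteen_le_pow (hr : 0 < r) (hK : 2 ≤ K) (hX : X = (2 * r) ^ 2 ^ K) : 16 ≤ X := by
  calc 16 = 2 ^ 2 ^ 2 := by norm_num
    _ ≤ (2 * r) ^ 2 ^ 2 := Nat.pow_le_pow_left (by omega) _
    _ ≤ (2 * r) ^ 2 ^ K :=
      Nat.pow_le_pow_right (by omega) (Nat.pow_le_pow_right (by norm_num) hK)
    _ = X := hX.symm

lemma succ_le_pow (hr : 0 < r) (hX : X = (2 * r) ^ 2 ^ K) : K + 1 ≤ X := by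
  calc K + 1 ≤ 2 ^ K := Nat.lt_two_pow_self
    _ ≤ 2 ^ 2 ^ K := Nat.lt_two_pow_self.le
    _ ≤ (2 * r) ^ 2 ^ K := Nat.pow_le_pow_left (by omega) _
    _ = X := hX.symm

lemma le_pow_two_mul (hX : X = (2 * r) ^ 2 ^ K) : r ≤ X := by
  calc r ≤ 2 * r := by omega
    _ ≤ (2 * r) ^ 2 ^ K := Nat.le_self_pow (by positivity) _
    _ = X := hX.symm

lemma inv_le_density (hr : 0 < r) (hX : X = (2 * r) ^ 2 ^ K) :
    (1 / X : ℝ) ≤ (1 / r) ^ 2 ^ K := by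
  have hr' : (0 : ℝ) < r := by exact_mod_cast hr
  rw [hX, div_pow, one_pow]
  push_cast
  refine one_div_le_one_div_of_le (by positivity) (pow_le_pow_left₀ hr'.le (by linarith) _)

lemma exists_cover_of_small_nat (hr : 0 < r) (hK : 2 ≤ K) (hX : X = (2 * r) ^ 2 ^ K)
    (χ : Finset (Fin n) → Fin r) (B R : Finset (Fin n)) (hBR : Disjoint B R)
    (hR : (1 + B.card) * X ^ 11 < R.card) :
    ∃ R₁ ⊆ R, Coverable (K + 1) χ (B ∪ R₁) (X ^ 4) ∧ R₁.card ≤ K * B.card ∧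
      K * B.card ≤ R₁.card + X ^ 3 := by
  have h16 : (16 : ℝ) ≤ X := by exact_mod_cast sixteen_le_pow hr hK hX
  have hKX : (K : ℝ) ≤ X := by
    have := succ_le_pow hr hX
    exact_mod_cast (by omega)
  have hrX : (r : ℝ) ≤ X := by exact_mod_cast le_pow_two_mul hX
  have hr' : (0 : ℝ) < r := by exact_mod_cast hr
  set δ : ℝ := (1 / r) ^ 2 ^ K with hδ
  set θ : ℝ := δ ^ 2 / (4 * r) with hθ
  have hX0 : (0 : ℝ) < X := by linarith
  have hX3 : 256 * (X : ℝ) ≤ X ^ 3 := by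
    calc 256 * (X : ℝ) = 16 ^ 2 * X := by norm_num
      _ ≤ X ^ 2 * X := by gcongr
      _ = X ^ 3 := by ring
  have hδX : 1 / (X : ℝ) ≤ δ := inv_le_density hr hX
  have hδ0 : 0 < δ := by positivity
  have hθ0 : 0 < θ := by positivity
  have hδ1 : 1 / δ ≤ X := (one_div_le hX0 hδ0).1 hδX
  have hθX : 1 / (4 * (X : ℝ) ^ 3) ≤ θ := by
    calc 1 / (4 * (X : ℝ) ^ 3) = (1 / X) ^ 2 / (4 * X) := by field_simp
      _ ≤ δ ^ 2 / (4 * r) := by gcongr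
  have hθ1 : 1 / θ ≤ 4 * X ^ 3 := (one_div_le (by positivity) hθ0).1 hθX
  have hσ : 1 / (X : ℝ) ^ 9 ≤ θ ^ 2 / 2 := by
    calc 1 / (X : ℝ) ^ 9 = 1 / (X ^ 3 * X ^ 6) := by ring
      _ ≤ 1 / (32 * (X : ℝ) ^ 6) := by
          gcongr
          linarith
      _ = (1 / (4 * (X : ℝ) ^ 3)) ^ 2 / 2 := by field_simp; norm_num
      _ ≤ θ ^ 2 / 2 := by gcongr
  have hR' : ((1 + B.card) * X ^ 11 : ℝ) < R.card := by exact_mod_cast hR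
  obtain ⟨R₁, h1, h2, h3, h4⟩ := exists_cover_of_small hr χ B R hBR hδ hθ (by
    calc (K * (K + K * B.card) : ℝ) = K ^ 2 * (1 + B.card) := by ring
      _ ≤ X ^ 2 * (1 + B.card) := by gcongr
      _ = 1 / (X : ℝ) ^ 9 * ((1 + B.card) * X ^ 11) := by field_simp
      _ < 1 / (X : ℝ) ^ 9 * R.card := by gcongr
      _ ≤ θ ^ 2 / 2 * R.card := by gcongr)
  refine ⟨R₁, h1, h2.mono ?_, h3, ?_⟩
  · calc 2 / δ + 2 / θ = 2 * (1 / δ) + 2 * (1 / θ) := by ring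
      _ ≤ 2 * X + 2 * (4 * X ^ 3) := by gcongr
      _ ≤ X ^ 3 + X ^ 3 * 8 := by linarith
      _ ≤ X ^ 3 * X := by nlinarith [pow_pos hX0 3]
      _ = X ^ 4 := by ring
  · have : (K * (2 / δ) : ℝ) ≤ X ^ 3 := by
      calc (K * (2 / δ) : ℝ) = 2 * K * (1 / δ) := by ring
        _ ≤ X * X * X := by gcongr; linarith
        _ = X ^ 3 := by ring
    exact_mod_cast h4.trans (by linarith : _ ≤ (R₁.card + X ^ 3 : ℝ))

lemma exists_absorber_nat (hr : 0 < r) (hK : 2 ≤ K) (hX : X = (2 * r) ^ 2 ^ K)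
    (χ : Finset (Fin n) → Fin r) (M N : ℕ) (hN : N ≤ M) (hM : (1 + M) * X ^ 63 ≤ n) :
    ∃ A R : Finset (Fin n), Disjoint A R ∧ R.card = M + N ∧
      ∀ R' ⊆ R, R'.card = M → Coverable (K + 1) χ (A ∪ R') (X ^ 6) := by
  have h16 : (16 : ℝ) ≤ X := by exact_mod_cast sixteen_le_pow hr hK hX
  have hKX : (K + 1 : ℝ) ≤ X := by exact_mod_cast succ_le_pow hr hX
  have hX0 : (0 : ℝ) < X := by linarith
  have hX1 : (1 : ℝ) ≤ X := by linarith
  set δ : ℝ := (1 / r) ^ 2 ^ K with hδ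
  set θ : ℝ := δ ^ 4 / 2 with hθ
  set γ : ℝ := θ ^ 5 / 4096 with hγ
  have hr' : (0 : ℝ) < r := by exact_mod_cast hr
  have hδX : 1 / (X : ℝ) ≤ δ := inv_le_density hr hX
  have hδ0 : 0 < δ := by positivity
  have hθ0 : 0 < θ := by positivity
  have hθX : 1 / (X : ℝ) ^ 5 ≤ θ := by
    calc 1 / (X : ℝ) ^ 5 = 1 / (X * X ^ 4) := by ring
      _ ≤ 1 / (2 * (X : ℝ) ^ 4) := by gcongr; linarith
      _ = (1 / (X : ℝ)) ^ 4 / 2 := by field_simp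
      _ ≤ δ ^ 4 / 2 := by gcongr
  have hγX : 1 / (X : ℝ) ^ 28 ≤ γ := by
    calc 1 / (X : ℝ) ^ 28 = (1 / (X : ℝ) ^ 5) ^ 5 / X ^ 3 := by field_simp
      _ ≤ θ ^ 5 / 16 ^ 3 := by gcongr
      _ = γ := by rw [hγ]; norm_num
  have hX63 : 0 < X ^ 63 := pow_pos (by exact_mod_cast hX0) _
  have hn : 0 < n := lt_of_lt_of_le (by positivity) hM
  have hM' : ((1 + M) * X ^ 63 : ℝ) ≤ n := by exact_mod_cast hM
  obtain ⟨A, R, h1, h2, h3⟩ := exists_absorber hr hn χ hδ hθ hγ M N (16 * M * X ^ 28) (4 * K + 4)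
    hN (by
      push_cast
      calc (16 * M : ℝ) = 1 / (X : ℝ) ^ 28 * (16 * M * X ^ 28) := by field_simp
        _ ≤ γ * (16 * M * X ^ 28) := by gcongr) rfl (by
      set L : ℝ := ((4 * K + 4 : ℕ) : ℝ) with hL
      have hLX : L ≤ X ^ 2 := by
        rw [hL]; push_cast
        nlinarith
      have hL0 : 0 ≤ L := Nat.cast_nonneg _
      have h28 : (1 : ℝ) ≤ X ^ 28 := one_le_pow₀ hX1
      push_cast
      calc L * (L + (L * (2 * M) + L * (16 * M * X ^ 28)))
          ≤ (X : ℝ) ^ 2 * (X ^ 2 + (X ^ 2 * (2 * M) + X ^ 2 * (16 * M * X ^ 28))) := by gcongr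
        _ = (X : ℝ) ^ 4 * (1 + M * (2 + 16 * X ^ 28)) := by ring
        _ ≤ (X : ℝ) ^ 4 * ((1 + M) * (18 * X ^ 28)) := by
            gcongr
            nlinarith [mul_nonneg (Nat.cast_nonneg (α := ℝ) M) (by linarith : (0 : ℝ) ≤ X ^ 28 - 1)]
        _ = 18 * (X : ℝ) ^ 32 * (1 + M : ℝ) := by ring
        _ ≤ (1 / 2 * (X : ℝ) ^ 2) * X ^ 32 * (1 + M : ℝ) := by
            gcongr
            nlinarith
        _ = 1 / 2 * (1 + M : ℝ) * X ^ 34 := by ring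
        _ ≤ 1 / 2 * (1 + M : ℝ) * X ^ 35 := by gcongr; norm_num
        _ = 1 / (X : ℝ) ^ 28 / 2 * ((1 + M) * X ^ 63) := by field_simp
        _ ≤ γ / 2 * n := by gcongr)
  refine ⟨A, R, h1, h2, fun R' hR' hc => (h3 R' hR' hc).mono ?_⟩
  calc 2 / θ = 2 * (1 / θ) := by ring
    _ ≤ 2 * X ^ 5 := by gcongr; exact (one_div_le (by positivity) hθ0).1 hθX
    _ ≤ X * X ^ 5 := by gcongr; linarith
    _ = X ^ 6 := by ring

/-- All but a small proportion of a set can be covered by boundedly many cycles. -/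
lemma exists_almost_cover (hr : 0 < r) (hK : 2 ≤ K) (hX : X = (2 * r) ^ 2 ^ K)
    (χ : Finset (Fin n) → Fin r) (U : Finset (Fin n)) (J : ℕ) :
    ∃ U' ⊆ U, Coverable (K + 1) χ (U \ U') (J * X ^ 4) ∧
      (U'.card : ℝ) ≤ X ^ 13 + (1 - 1 / (X : ℝ) ^ 13) ^ J * U.card := by
  have h16' := sixteen_le_pow hr hK hX
  have h16 : (16 : ℝ) ≤ X := by exact_mod_cast h16'
  have hX0 : (0 : ℝ) < X := by linarith
  have hX1 : (1 : ℝ) ≤ X := by linarith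
  have hd : 0 ≤ 1 - 1 / (X : ℝ) ^ 13 := by
    rw [sub_nonneg, div_le_one (by positivity)]
    exact one_le_pow₀ hX1
  have hd1 : 1 - 1 / (X : ℝ) ^ 13 ≤ 1 := by
    have : 0 ≤ 1 / (X : ℝ) ^ 13 := by positivity
    linarith
  induction J with
  | zero =>
    refine ⟨U, subset_rfl, ?_, ?_⟩
    · rw [sdiff_self]
      exact (coverable_singletons K.succ_pos ∅).mono (by simp)
    · simp
  | succ J ih =>
    obtain ⟨U', hU', hcov, hc⟩ := ih
    have hJ : (J * X ^ 4 : ℝ) ≤ ((J + 1 : ℕ) : ℝ) * X ^ 4 := by push_cast; nlinarith [pow_pos hX0 4]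
    by_cases hs : U'.card ≤ X ^ 13
    · refine ⟨U', hU', hcov.mono hJ, ?_⟩
      have h1 : (U'.card : ℝ) ≤ X ^ 13 := by exact_mod_cast hs
      have h2 : 0 ≤ (1 - 1 / (X : ℝ) ^ 13) ^ (J + 1) * U.card := by positivity
      linarith
    push Not at hs
    obtain ⟨B, hB, hBc⟩ := exists_subset_card_eq (Nat.div_le_self U'.card (X ^ 12))
    have hX12 : 0 < X ^ 12 := by positivity
    have hdm := Nat.div_add_mod U'.card (X ^ 12)
    have hml := Nat.mod_lt U'.card hX12
    rw [← hBc] at hdm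
    have hmul : X ^ 12 * B.card ≤ U'.card := (Nat.le_add_right _ _).trans hdm.le
    obtain ⟨R₁, hR₁, hcov₁, -, -⟩ := exists_cover_of_small_nat hr hK hX χ B (U' \ B)
      disjoint_sdiff (by
        rw [card_sdiff_of_subset hB]
        have e1 : X ^ 12 = X * X ^ 11 := by ring
        have e2 : X ^ 13 = X * X * X ^ 11 := by ring
        have hX11 : 0 < X ^ 11 := by positivity
        have e3 : 256 * X ^ 11 ≤ X ^ 13 := by rw [e2]; gcongr; nlinarith
        have e4 : 16 * (X ^ 11 * B.card) ≤ U'.card := by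
          refine le_trans ?_ hmul
          rw [e1, mul_assoc]
          gcongr
        have e5 : B.card ≤ X ^ 11 * B.card := Nat.le_mul_of_pos_left _ hX11
        have e6 : (1 + B.card) * X ^ 11 = X ^ 11 + X ^ 11 * B.card := by ring
        omega)
    have hBR₁ : B ∪ R₁ ⊆ U' := union_subset hB (hR₁.trans sdiff_subset)
    refine ⟨U' \ (B ∪ R₁), sdiff_subset.trans hU', ?_, ?_⟩
    · have e : U \ (U' \ (B ∪ R₁)) = (U \ U') ∪ (B ∪ R₁) := by
        rw [sdiff_sdiff_right']
        congr 1
        exact inter_eq_right.2 (hBR₁.trans hU')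
      rw [e]
      refine (hcov.union hcov₁ (disjoint_of_subset_right hBR₁ sdiff_disjoint)).mono (le_of_eq ?_)
      push_cast
      ring
    · have h1 : ((U' \ (B ∪ R₁)).card : ℝ) ≤ U'.card - B.card := by
        have h2 := card_le_card (sdiff_subset_sdiff (subset_rfl : U' ⊆ U')
          (subset_union_left : B ⊆ B ∪ R₁))
        rw [card_sdiff_of_subset hB] at h2
        have h3 := card_le_card hB
        have : (U' \ (B ∪ R₁)).card + B.card ≤ U'.card := by omega
        have : ((U' \ (B ∪ R₁)).card : ℝ) + B.card ≤ U'.card := by exact_mod_cast this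
        linarith
      have h2 : (1 / (X : ℝ) ^ 13) * U'.card ≤ B.card := by
        have h3 : U'.card ≤ X ^ 13 * B.card := by
          have h4 : 1 ≤ B.card := by
            by_contra h0
            have : B.card = 0 := by omega
            rw [this] at hdm
            have : X ^ 12 ≤ X ^ 13 := Nat.pow_le_pow_right (by omega) (by norm_num)
            omega
          calc U'.card ≤ X ^ 12 * B.card + X ^ 12 * 1 := by omega
            _ ≤ X ^ 12 * B.card + X ^ 12 * B.card := by gcongr
            _ = X ^ 12 * 2 * B.card := by ring
            _ ≤ X ^ 12 * X * B.card := by gcongr; omega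
            _ = X ^ 13 * B.card := by ring
        rw [one_div, inv_mul_le_iff₀ (by positivity)]
        exact_mod_cast h3
      calc ((U' \ (B ∪ R₁)).card : ℝ) ≤ U'.card - B.card := h1
        _ ≤ (1 - 1 / (X : ℝ) ^ 13) * U'.card := by linarith
        _ ≤ (1 - 1 / (X : ℝ) ^ 13) * (X ^ 13 + (1 - 1 / (X : ℝ) ^ 13) ^ J * U.card) := by gcongr
        _ = (1 - 1 / (X : ℝ) ^ 13) * X ^ 13 + (1 - 1 / (X : ℝ) ^ 13) ^ (J + 1) * U.card := by ring
        _ ≤ _ := by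
          gcongr
          exact mul_le_of_le_one_left (by positivity) hd1

end Quantitative

section Assembly

lemma one_sub_pow_le {X : ℝ} (h16 : 16 ≤ X) {J : ℕ} (hJ : (J : ℝ) = X ^ 16) :
    (1 - 1 / X ^ 13) ^ J ≤ 1 / X ^ 79 := by
  have hX0 : 0 < X := by linarith
  have h1 : (1 : ℝ) / X ^ 13 ≤ 1 := by
    rw [div_le_one (by positivity)]
    exact one_le_pow₀ (by linarith)
  have h2 : X ^ 79 ≤ Real.exp (X ^ 3) := by
    calc X ^ 79 ≤ Real.exp X ^ 79 :=
          pow_le_pow_left₀ hX0.le (by linarith [Real.add_one_le_exp X]) _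
      _ = Real.exp (79 * X) := by rw [← Real.exp_nat_mul]; norm_num
      _ ≤ Real.exp (X ^ 3) := by
          refine Real.exp_le_exp.2 ?_
          calc 79 * X ≤ 16 ^ 2 * X := by linarith
            _ ≤ X ^ 2 * X := by gcongr
            _ = X ^ 3 := by ring
  calc (1 - 1 / X ^ 13) ^ J ≤ Real.exp (-(1 / X ^ 13)) ^ J :=
        pow_le_pow_left₀ (by linarith) (by linarith [Real.add_one_le_exp (-(1 / X ^ 13))]) _
    _ = Real.exp (-(X ^ 3)) := by
        rw [← Real.exp_nat_mul, hJ]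
        congr 1
        field_simp
    _ ≤ 1 / X ^ 79 := by
        rw [Real.exp_neg, ← one_div]
        exact one_div_le_one_div_of_le (by positivity) h2

lemma coverable_univ {n r K X : ℕ} (hr : 0 < r) (hK : 2 ≤ K) (hX : X = (2 * r) ^ 2 ^ K)
    (hn : X ^ 100 ≤ n) (χ : Finset (Fin n) → Fin r) :
    Coverable (K + 1) χ univ ((X : ℝ) ^ 32) := by
  have h16' := sixteen_le_pow hr hK hX
  have h16 : (16 : ℝ) ≤ X := by exact_mod_cast h16'
  have hX0 : (0 : ℝ) < X := by linarith
  have hX0' : 0 < X := by omega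
  have hX1 : (1 : ℝ) ≤ X := by linarith
  have hKX' := succ_le_pow (K := K) hr hX
  have hKX : (K + 1 : ℝ) ≤ X := by exact_mod_cast hKX'
  have hnR : (X : ℝ) ^ 100 ≤ n := by exact_mod_cast hn
  have hpow : ∀ i j : ℕ, i ≤ j → (X : ℝ) ^ i ≤ X ^ j := fun i j h => pow_le_pow_right₀ hX1 h
  set M := n / X ^ 64 with hM
  set N := n / X ^ 77 with hN
  have hNM : N ≤ M := Nat.div_le_div_left (Nat.pow_le_pow_right hX0' (by norm_num)) (by positivity)
  have hM1 : (M : ℝ) * X ^ 64 ≤ n := by exact_mod_cast Nat.div_mul_le_self n (X ^ 64)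
  have hN1 : (N : ℝ) * X ^ 77 ≤ n := by exact_mod_cast Nat.div_mul_le_self n (X ^ 77)
  have hM2 : (n : ℝ) < X ^ 64 * (M + 1) := by
    exact_mod_cast Nat.lt_mul_div_succ n (pow_pos hX0' 64)
  have hN2 : (n : ℝ) < X ^ 77 * (N + 1) := by
    exact_mod_cast Nat.lt_mul_div_succ n (pow_pos hX0' 77)
  obtain ⟨A, R, hAR, hR, habs⟩ := exists_absorber_nat hr hK hX χ M N hNM (by
    have : ((1 + M) * X ^ 63 : ℝ) ≤ n := by
      have h1 : (M : ℝ) * X ^ 63 * 16 ≤ n := by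
        calc (M : ℝ) * X ^ 63 * 16 ≤ (M : ℝ) * X ^ 63 * X := by gcongr
          _ = (M : ℝ) * X ^ 64 := by ring
          _ ≤ (n : ℝ) := hM1
      have h2 : (X : ℝ) ^ 63 * 16 ≤ n := by
        calc (X : ℝ) ^ 63 * 16 ≤ (X : ℝ) ^ 63 * X := by gcongr
          _ = (X : ℝ) ^ 64 := by ring
          _ ≤ (X : ℝ) ^ 100 := hpow _ _ (by norm_num)
          _ ≤ (n : ℝ) := hnR
      linarith
    exact_mod_cast this)
  obtain ⟨B, hB, hBcov, hBc⟩ := exists_almost_cover hr hK hX χ (univ \ (A ∪ R)) (X ^ 16)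
  have hb : K * B.card ≤ N := by
    have h1 : (B.card : ℝ) ≤ X ^ 13 + 1 / X ^ 79 * n := by
      have h2 : (((univ : Finset (Fin n)) \ (A ∪ R)).card : ℝ) ≤ n := by
        exact_mod_cast (card_le_univ _).trans (Fintype.card_fin n).le
      have h3 := one_sub_pow_le h16 (J := X ^ 16) (by push_cast; rfl)
      have h4 : (0 : ℝ) ≤ 1 / X ^ 79 := by positivity
      refine hBc.trans (add_le_add le_rfl ?_)
      calc _ ≤ 1 / (X : ℝ) ^ 79 * ((univ : Finset (Fin n)) \ (A ∪ R)).card := by gcongr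
        _ ≤ _ := by gcongr
    have h5 : (X : ℝ) * B.card < N + 1 - 1 := by
      refine lt_sub_iff_add_lt.2 (lt_of_mul_lt_mul_left (lt_of_le_of_lt ?_ hN2) (by positivity))
      have h6 : (X : ℝ) ^ 92 ≤ n := (hpow 92 100 (by norm_num)).trans hnR
      have h7 : (X : ℝ) ^ 77 ≤ X ^ 91 := hpow _ _ (by norm_num)
      have h8 : (X : ℝ) ^ 91 * 16 ≤ X ^ 92 := by rw [pow_succ _ 91]; gcongr
      have h9 : (1 : ℝ) / X * n ≤ 1 / 16 * n := by gcongr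
      calc (X : ℝ) ^ 77 * (X * B.card + 1) ≤ (X : ℝ) ^ 77 * (X * (X ^ 13 + 1 / X ^ 79 * n) + 1) := by
            gcongr
        _ = (X : ℝ) ^ 91 + 1 / X * n + X ^ 77 := by field_simp
        _ ≤ (n : ℝ) := by linarith
    have h6 : ((K * B.card : ℕ) : ℝ) < N + 1 := by
      push_cast
      have : (K : ℝ) * B.card ≤ X * B.card := by gcongr; linarith
      linarith
    exact Nat.lt_succ_iff.1 (by exact_mod_cast h6)
  have hNM' : (1 + N) * X ^ 11 < M := by
    have h : ((1 + N) * X ^ 11 : ℝ) < M := by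
      refine lt_of_add_lt_add_right (a := (1 : ℝ))
        (lt_of_mul_lt_mul_left (lt_of_le_of_lt ?_ hM2) (by positivity))
      have h1 : (N : ℝ) * X ^ 75 * 16 ≤ n := by
        calc (N : ℝ) * X ^ 75 * 16 ≤ (N : ℝ) * X ^ 75 * X ^ 2 := by
              gcongr
              nlinarith
          _ = (N : ℝ) * X ^ 77 := by ring
          _ ≤ (n : ℝ) := hN1
      have h2 : (X : ℝ) ^ 64 ≤ X ^ 75 := hpow _ _ (by norm_num)
      have h3 : (X : ℝ) ^ 75 * 16 ≤ X ^ 76 := by rw [pow_succ _ 75]; gcongr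
      have h4 : (X : ℝ) ^ 76 ≤ n := (hpow 76 100 (by norm_num)).trans hnR
      calc (X : ℝ) ^ 64 * ((1 + N) * X ^ 11 + 1) = (X : ℝ) ^ 75 + N * X ^ 75 + X ^ 64 := by ring
        _ ≤ (n : ℝ) := by linarith
    exact_mod_cast h
  obtain ⟨e, he1, he2⟩ : ∃ e, e * (K + 1) ≤ N - K * B.card ∧ N - K * B.card < (K + 1) * (e + 1) :=
    ⟨_, Nat.div_mul_le_self _ _, Nat.lt_mul_div_succ _ K.succ_pos⟩
  have hKe : K * (B.card + e) = K * B.card + K * e := mul_add _ _ _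
  have he3 : e + K * (B.card + e) ≤ N := by
    have : e * (K + 1) = e + K * e := by ring
    omega
  have hbe : B.card + e ≤ N := by
    have : 1 * (B.card + e) ≤ K * (B.card + e) := Nat.mul_le_mul_right _ (by omega)
    omega
  obtain ⟨E, hE, hEc⟩ := exists_subset_card_eq (s := R) (n := e) (by omega)
  have hBR : Disjoint B R := disjoint_of_subset_left hB
    (disjoint_of_subset_right subset_union_right sdiff_disjoint)
  have hBA : Disjoint B A := disjoint_of_subset_left hB
    (disjoint_of_subset_right subset_union_left sdiff_disjoint)
  have hBEc : (B ∪ E).card = B.card + e := by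
    rw [card_union_of_disjoint (disjoint_of_subset_right hE hBR), hEc]
  obtain ⟨R₁, hR₁, hcov₁, hR₁c, hR₁c'⟩ := exists_cover_of_small_nat hr hK hX χ (B ∪ E) (R \ E)
    (disjoint_union_left.2 ⟨disjoint_of_subset_right sdiff_subset hBR, disjoint_sdiff⟩) (by
      rw [hBEc, card_sdiff_of_subset hE, hR, hEc]
      have : (1 + (B.card + e)) * X ^ 11 ≤ (1 + N) * X ^ 11 := by gcongr
      omega)
  rw [hBEc] at hR₁c hR₁c'
  have hZc : ((R \ E) \ R₁).card = M + N - e - R₁.card := by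
    rw [card_sdiff_of_subset hR₁, card_sdiff_of_subset hE, hR, hEc]
  obtain ⟨R', hR', hR'c⟩ := exists_subset_card_eq (s := (R \ E) \ R₁) (n := M) (by omega)
  have hR'R : R' ⊆ R := hR'.trans (sdiff_subset.trans sdiff_subset)
  have hrest : ((((R \ E) \ R₁) \ R').card : ℝ) ≤ K + X ^ 3 := by
    rw [card_sdiff_of_subset hR', hZc, hR'c]
    have h1 : (K + 1) * (e + 1) = e + K * e + K + 1 := by ring
    exact_mod_cast (by omega : M + N - e - R₁.card - M ≤ K + X ^ 3)
  have hER : ∀ v, v ∈ E → v ∈ R := fun v h => hE h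
  have hR₁R : ∀ v, v ∈ R₁ → v ∈ R ∧ v ∉ E := fun v h => mem_sdiff.1 (hR₁ h)
  have hR'R₁ : ∀ v, v ∈ R' → (v ∈ R ∧ v ∉ E) ∧ v ∉ R₁ := fun v h => by
    simpa only [mem_sdiff] using hR' h
  have hBR' : ∀ v, v ∈ B → v ∉ R := fun v h => disjoint_left.1 hBR h
  have hBA' : ∀ v, v ∈ B → v ∉ A := fun v h => disjoint_left.1 hBA h
  have hAR' : ∀ v, v ∈ A → v ∉ R := fun v h => disjoint_left.1 hAR h
  have hd₁ : Disjoint ((univ \ (A ∪ R)) \ B) (B ∪ E ∪ R₁) := by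
    clear * - hER hR₁R
    simp only [disjoint_left, mem_sdiff, mem_univ, true_and, mem_union]
    grind
  have hd₂ : Disjoint ((univ \ (A ∪ R)) \ B ∪ (B ∪ E ∪ R₁)) (A ∪ R') := by
    clear * - hER hR₁R hR'R₁ hBR' hBA' hAR'
    simp only [disjoint_left, mem_sdiff, mem_univ, true_and, mem_union]
    grind
  have hd₃ : Disjoint ((univ \ (A ∪ R)) \ B ∪ (B ∪ E ∪ R₁) ∪ (A ∪ R')) (((R \ E) \ R₁) \ R') := by
    clear * - hBR' hAR'
    simp only [disjoint_left, mem_sdiff, mem_univ, true_and, mem_union]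
    grind
  have hun : (univ \ (A ∪ R)) \ B ∪ (B ∪ E ∪ R₁) ∪ (A ∪ R') ∪ (((R \ E) \ R₁) \ R') = univ := by
    clear * -
    simp only [eq_univ_iff_forall, mem_sdiff, mem_univ, true_and, mem_union]
    grind
  rw [← hun]
  refine (((hBcov.union hcov₁ hd₁).union (habs R' hR'R hR'c) hd₂).union
    ((coverable_singletons K.succ_pos _).mono hrest) hd₃).mono ?_
  have h1 : (X : ℝ) ^ 20 * 16 ≤ X ^ 21 := by rw [pow_succ _ 20]; gcongr
  have h2 := hpow 21 32 (by norm_num)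
  have h3 := hpow 4 20 (by norm_num)
  have h4 := hpow 6 20 (by norm_num)
  have h5 := hpow 3 20 (by norm_num)
  have h6 := hpow 1 20 (by norm_num)
  have h7 : (((X ^ 16 : ℕ) : ℝ)) * X ^ 4 = X ^ 20 := by push_cast; ring
  have h8 : (0 : ℝ) < X ^ 20 := by positivity
  rw [h7]
  linarith

end Assembly

theorem monochromatic_tight_cycle_partition (r k : ℕ) (hk : 3 ≤ k) :
    ∃ n₀ : ℕ, ∀ n : ℕ, n₀ ≤ n → ∀ χ : Finset (Fin n) → Fin r,
      ∃ 𝒞 : Finset (Finset (Fin n)),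
        (∀ C ∈ 𝒞, MonoTightCycle k χ C) ∧
        (𝒞 : Set (Finset (Fin n))).PairwiseDisjoint id ∧
        𝒞.biUnion id = Finset.univ ∧
        (𝒞.card : ℝ) ≤ (2 * r : ℝ) ^ (2 ^ (k + 4)) + 2 ^ (k + 8) * r * Real.log (2 * r) := by
  obtain ⟨K, rfl⟩ : ∃ K, k = K + 1 := ⟨k - 1, by omega⟩
  refine ⟨((2 * r) ^ 2 ^ K) ^ 100, fun n hn χ => ?_⟩
  have hr : 0 < r := (χ ∅).pos
  have hr1 : (1 : ℝ) ≤ r := by exact_mod_cast hr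
  obtain ⟨𝒞, h1, h2, h3, h4⟩ := coverable_univ hr (by omega) rfl hn χ
  refine ⟨𝒞, h1, h2, h3, h4.trans ?_⟩
  have hlog : 0 ≤ Real.log (2 * r) := Real.log_nonneg (by linarith)
  have e : ((((2 * r) ^ 2 ^ K : ℕ) : ℝ)) ^ 32 = (2 * r : ℝ) ^ 2 ^ (K + 1 + 4) := by
    push_cast
    rw [← pow_mul, add_assoc, pow_add]
    norm_num
  rw [e]
  have : 0 ≤ 2 ^ (K + 1 + 8) * r * Real.log (2 * r) := by positivity
  linarith
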